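/- arXiv:1704.03109 — 3 statements merged into one kernel-verified Lean document; each statement's English description precedes it below -/
import Mathlib

section
/- Let O be a valuation ring with maximal ideal m whose value group embeds into the real numbers (i.e., O has rank at most one). Let π be a nonzero element of m, let A be a finitely presented algebra over O/(π), and let M be a finitely presented A-module (note that M is then O-torsion, being killed by π). Then there exist a natural number k, nonzero elements π₁, …, π_k of m, and finite or countable index types I₁, …, I_k such that, as an O-module, M is isomorphic to the direct sum ⊕_{i=1}^{k} (O/(π_i))^{(I_i)}, where (O/(π_i))^{(I_i)} denotes the direct sum of I_i copies of the cyclic module O/(π_i). -/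
namespace TorsionStructure

section LeadingTerms

variable {O : Type*} [CommRing O]

theorem exists_dvd_pow_of_rank_le_one [IsDomain O] [ValuationRing O]
    (hrank : ∃ f : ValuationRing.ValueGroup O (FractionRing O) →*₀ NNReal, StrictMono f)
    {π d : O} (hπ : π ≠ 0) (hd : d ∈ IsLocalRing.maximalIdeal O) : ∃ s : ℕ, π ∣ d ^ s := by
  obtain ⟨f, hf⟩ := hrank
  let v := ValuationRing.valuation O (FractionRing O)
  have dvd_of_le : ∀ a b : O, a ≠ 0 → v (algebraMap O _ b) ≤ v (algebraMap O _ a) → a ∣ b := by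
    intro a b ha h
    have ha' : algebraMap O (FractionRing O) a ≠ 0 := by simpa using ha
    have h1 : v (algebraMap O _ b / algebraMap O _ a) ≤ 1 := by
      rw [map_div₀]
      exact div_le_one_of_le₀ h zero_le
    obtain ⟨c, hc⟩ := (ValuationRing.mem_integer_iff O (FractionRing O) _).1 h1
    refine ⟨c, IsFractionRing.injective O (FractionRing O) ?_⟩
    rw [map_mul, hc, mul_div_cancel₀ _ ha']
  have h1 : v (algebraMap O _ d) < 1 := by
    by_contra! h
    have := dvd_of_le d 1
    by_cases hd0 : d = 0
    · simp [hd0] at h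
    · exact (IsLocalRing.mem_maximalIdeal _).1 hd
        (isUnit_of_dvd_one (this hd0 (by simpa using h)))
  have h2 : f (v (algebraMap O _ d)) < 1 := by simpa using hf h1
  have h3 : 0 < f (v (algebraMap O _ π)) := by
    have h : 0 < v (algebraMap O (FractionRing O) π) := by
      rw [Valuation.pos_iff]
      simpa using hπ
    simpa using hf h
  obtain ⟨s, hs⟩ := exists_pow_lt_of_lt_one h3 h2
  refine ⟨s, dvd_of_le _ _ hπ ?_⟩
  rw [map_pow, map_pow]
  refine (hf.lt_iff_lt.1 ?_).le
  rwa [map_pow]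

theorem exists_mem_forall_dvd [PreValuationRing O] {ι : Type*} {s : Finset ι} (hs : s.Nonempty)
    (a : ι → O) : ∃ i ∈ s, ∀ j ∈ s, a i ∣ a j := by
  induction hs using Finset.Nonempty.cons_induction with
  | singleton i => exact ⟨i, by simp, by simp⟩
  | cons i s hi hs ih =>
    obtain ⟨k, hk, h⟩ := ih
    rcases ValuationRing.dvd_total (a i) (a k) with h' | h'
    · exact ⟨i, by simp, by simpa using fun j hj => h'.trans (h j hj)⟩
    · exact ⟨k, by simp [hk], by simpa [h'] using h⟩

theorem exists_mem_maximalIdeal_forall_dvd [IsLocalRing O] [PreValuationRing O] {ι : Type*}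
    (s : Finset ι) (a : ι → O) (ha : ∀ i ∈ s, a i ∈ IsLocalRing.maximalIdeal O) :
    ∃ d ∈ IsLocalRing.maximalIdeal O, ∀ i ∈ s, d ∣ a i := by
  rcases s.eq_empty_or_nonempty with rfl | hs
  · exact ⟨0, zero_mem _, by simp⟩
  · obtain ⟨i, hi, h⟩ := exists_mem_forall_dvd hs a
    exact ⟨a i, ha i hi, h⟩

variable {E : Type*}

theorem exists_eq_smul_of_forall_dvd {c : O} {v : E →₀ O} (h : ∀ e, c ∣ v e) :
    ∃ u : E →₀ O, v = c • u ∧ ∀ e, v e = 0 → u e = 0 := by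
  classical
  choose b hb using h
  refine ⟨Finsupp.onFinset v.support (fun e => if v e = 0 then 0 else b e) (by simp; tauto),
    ?_, fun e he => by simp [he]⟩
  ext e
  by_cases h : v e = 0
  · simp [h]
  · simpa [h] using hb e

theorem exists_mem_maximalIdeal_eq_smul [IsLocalRing O] [PreValuationRing O] {v : E →₀ O}
    (h : ∀ e, v e ∈ IsLocalRing.maximalIdeal O) :
    ∃ d ∈ IsLocalRing.maximalIdeal O, ∃ u : E →₀ O, v = d • u := by
  obtain ⟨d, hd, hdv⟩ := exists_mem_maximalIdeal_forall_dvd v.support v fun e _ => h e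
  obtain ⟨u, hu, -⟩ := exists_eq_smul_of_forall_dvd (c := d) (v := v) fun e => by
    by_cases he : v e = 0
    · simp [he]
    · exact hdv e (by simpa using he)
  exact ⟨d, hd, u, hu⟩

/-- Every nonzero vector is one of its coefficients times a vector with a coefficient `1`. -/
theorem exists_content [IsDomain O] [PreValuationRing O] {v : E →₀ O} (hv : v ≠ 0) :
    ∃ e, v e ≠ 0 ∧ ∃ u : E →₀ O, v = v e • u ∧ u e = 1 ∧ ∀ e, v e = 0 → u e = 0 := by
  obtain ⟨e, he, h⟩ := exists_mem_forall_dvd (Finsupp.support_nonempty_iff.2 hv) v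
  obtain ⟨u, hu, hu'⟩ := exists_eq_smul_of_forall_dvd (c := v e) (v := v) fun e' => by
    by_cases he : v e' = 0
    · simp [he]
    · exact h e' (by simpa using he)
  have he : v e ≠ 0 := by simpa using he
  refine ⟨e, he, u, hu, mul_left_cancel₀ he ?_, hu'⟩
  simpa using (DFunLike.congr_fun hu e).symm

theorem linearCombination_apply_apply (f : E → E →₀ O) (a : E →₀ O) (e : E) :
    Finsupp.linearCombination O f a e = ∑ i ∈ a.support, a i * f i e := by
  simp [Finsupp.linearCombination_apply, Finsupp.sum, Finsupp.finsetSum_apply]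

variable [LinearOrder E]

/-- Modulo `I`, the vector `v` is monic with leading term `e`. -/
def Lead (I : Ideal O) (e : E) (v : E →₀ O) : Prop :=
  v e - 1 ∈ I ∧ ∀ e' > e, v e' ∈ I

theorem lead_single (I : Ideal O) (e : E) : Lead I e (Finsupp.single e 1) := by
  refine ⟨by simp, fun e' he' => ?_⟩
  rw [Finsupp.single_eq_of_ne he'.ne']
  exact zero_mem _

theorem Lead.mono {I J : Ideal O} (h : I ≤ J) {e : E} {v : E →₀ O} (hv : Lead I e v) :
    Lead J e v :=
  ⟨h hv.1, fun e' he' => h (hv.2 e' he')⟩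

theorem Lead.span_mono {c d : O} (h : c ∣ d) {e : E} {v : E →₀ O} (hv : Lead (Ideal.span {d}) e v) :
    Lead (Ideal.span {c}) e v :=
  hv.mono (Ideal.span_singleton_le_span_singleton.2 h)

theorem Lead.exists_span [IsLocalRing O] [PreValuationRing O] {e : E} {v : E →₀ O}
    (hv : Lead (IsLocalRing.maximalIdeal O) e v) :
    ∃ d ∈ IsLocalRing.maximalIdeal O, Lead (Ideal.span {d}) e v := by
  classical
  obtain ⟨d, hd, h⟩ := exists_mem_maximalIdeal_forall_dvd (insert e (v.support.filter (e < ·)))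
    (fun e' => if e' = e then v e - 1 else v e') (by
      intro i hi
      by_cases hie : i = e
      · simpa [hie] using hv.1
      · simp [hie] at hi
        simpa [hie] using hv.2 i hi.2)
  refine ⟨d, hd, ?_, fun e' he' => ?_⟩
  · have := h e (by simp)
    simpa [Ideal.mem_span_singleton] using this
  · rw [Ideal.mem_span_singleton]
    by_cases h0 : v e' = 0
    · simp [h0]
    · simpa [he'.ne'] using h e' (by simp [h0, he'])

/-- A vector with a unit coefficient has a leading term after rescaling. -/
theorem exists_lead_of_not_mem [IsLocalRing O] {v : E →₀ O} {e : E}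
    (he : v e ∉ IsLocalRing.maximalIdeal O) :
    ∃ e, v e ∉ IsLocalRing.maximalIdeal O ∧
      (∀ e' > e, v e' ∈ IsLocalRing.maximalIdeal O) := by
  classical
  have hs : (v.support.filter fun e => v e ∉ IsLocalRing.maximalIdeal O).Nonempty :=
    ⟨e, Finset.mem_filter.2 ⟨Finsupp.mem_support_iff.2 fun h => he (h ▸ zero_mem _), he⟩⟩
  obtain ⟨e₀, h₀, h⟩ := Finset.exists_max_image _ id hs
  refine ⟨e₀, (Finset.mem_filter.1 h₀).2, fun e' he' => ?_⟩
  by_contra h'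
  exact absurd (h e' (Finset.mem_filter.2
    ⟨Finsupp.mem_support_iff.2 fun h => h' (h ▸ zero_mem _), h'⟩)) (not_le.2 he')

theorem exists_lead_smul [IsLocalRing O] {v : E →₀ O} {e : E} (he : v e ∉ IsLocalRing.maximalIdeal O)
    (hv : ∀ e' > e, v e' ∈ IsLocalRing.maximalIdeal O) :
    ∃ c : O, Lead (IsLocalRing.maximalIdeal O) e (c • v) := by
  obtain ⟨c, hc⟩ := (IsLocalRing.notMem_maximalIdeal.1 he).exists_left_inv
  exact ⟨c, by simp [hc], fun e' he' => by simpa using Ideal.mul_mem_left _ c (hv e' he')⟩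

/-- The leading term of a combination of monic vectors. -/
theorem linearCombination_lead {I : Ideal O} {f : E → E →₀ O} (hf : ∀ e, Lead I e (f e))
    {a : E →₀ O} {e : E} (ha : ∀ e' > e, a e' ∈ I) :
    Finsupp.linearCombination O f a e - a e ∈ I ∧
      ∀ e' > e, Finsupp.linearCombination O f a e' ∈ I := by
  classical
  have key : ∀ e' ≥ e, ∀ i, i ≠ e → a i * f i e' ∈ I := by
    intro e' he' i hi
    rcases lt_or_gt_of_ne hi with h | h
    · exact Ideal.mul_mem_left _ _ ((hf i).2 e' (h.trans_le he'))
    · exact Ideal.mul_mem_right _ _ (ha i h)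
  constructor
  · have h1 : ∀ i, a i * f i e - (if i = e then a e else 0) ∈ I := by
      intro i
      by_cases hi : i = e
      · subst hi
        simpa [mul_sub] using Ideal.mul_mem_left _ (a i) (hf i).1
      · simpa [hi] using key e le_rfl i hi
    have h2 : a e = ∑ i ∈ a.support, (if i = e then a e else 0) := by
      simp [Finset.sum_ite_eq']
    rw [linearCombination_apply_apply]
    have := Ideal.sum_mem I (t := a.support) fun i _ => h1 i
    rwa [Finset.sum_sub_distrib, ← h2] at this
  · intro e' he'
    rw [linearCombination_apply_apply]
    refine Ideal.sum_mem _ fun i _ => ?_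
    by_cases hi : i = e
    · subst hi
      exact Ideal.mul_mem_left _ _ ((hf i).2 e' he')
    · exact key e' he'.le i hi

theorem exists_linearCombination_add_smul [WellFoundedLT E] {d : O} {f : E → E →₀ O}
    (hf : ∀ e, Lead (Ideal.span {d}) e (f e)) (v : E →₀ O) :
    ∃ a w : E →₀ O, v = Finsupp.linearCombination O f a + d • w := by
  classical
  let Q : Submodule O (E →₀ O) :=
    LinearMap.range (Finsupp.linearCombination O f) ⊔
      LinearMap.range (d • LinearMap.id : (E →₀ O) →ₗ[O] (E →₀ O))
  have hQf : ∀ e, f e ∈ Q := fun e =>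
    Submodule.mem_sup_left ⟨Finsupp.single e 1, by simp⟩
  have hQd : ∀ v : E →₀ O, d • v ∈ Q := fun v => Submodule.mem_sup_right ⟨v, by simp⟩
  have hQ1 : ∀ e, Finsupp.single e (1 : O) ∈ Q := by
    intro e
    induction e using WellFoundedLT.induction with
    | ind e ih =>
      have h : f e - Finsupp.single e 1 ∈ Q := by
        rw [← Finsupp.sum_single (f e - Finsupp.single e 1)]
        refine Submodule.sum_mem _ fun i _ => ?_
        have hdvd : ∀ x : O, x ∈ Ideal.span {d} → Finsupp.single i x ∈ Q := by
          intro x hx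
          obtain ⟨y, rfl⟩ := Ideal.mem_span_singleton.1 hx
          rw [← smul_eq_mul, ← Finsupp.smul_single]
          exact hQd _
        rcases lt_trichotomy i e with h | h | h
        · rw [← Finsupp.smul_single_one]
          exact Q.smul_mem _ (ih i h)
        · subst h
          exact hdvd _ (by simpa using (hf i).1)
        · refine hdvd _ ?_
          simpa [Finsupp.single_eq_of_ne h.ne'] using (hf e).2 i h
      simpa using Q.sub_mem (hQf e) h
  have : v ∈ Q := by
    rw [← Finsupp.sum_single v]
    refine Submodule.sum_mem _ fun i _ => ?_
    rw [← Finsupp.smul_single_one]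
    exact Q.smul_mem _ (hQ1 i)
  obtain ⟨_, ⟨a, rfl⟩, _, ⟨w, rfl⟩, h⟩ := Submodule.mem_sup.1 this
  exact ⟨a, w, h.symm⟩

theorem exists_linearCombination_add_smul_of_dvd_pow [WellFoundedLT E] {c d : O} {s : ℕ}
    (hc : c ∣ d ^ s) {f : E → E →₀ O} (hf : ∀ e, Lead (Ideal.span {d}) e (f e)) (v : E →₀ O) :
    ∃ a w : E →₀ O, v = Finsupp.linearCombination O f a + c • w := by
  obtain ⟨r, hr⟩ := hc
  suffices h : ∀ s, ∃ a w : E →₀ O, v = Finsupp.linearCombination O f a + d ^ s • w by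
    obtain ⟨a, w, h⟩ := h s
    exact ⟨a, r • w, by rw [h, hr, mul_smul]⟩
  intro s
  induction s with
  | zero => exact ⟨0, v, by simp⟩
  | succ s ih =>
    obtain ⟨a, w, h⟩ := ih
    obtain ⟨a', w', h'⟩ := exists_linearCombination_add_smul hf w
    refine ⟨a + d ^ s • a', w', ?_⟩
    rw [h, h', map_add, map_smul, smul_add, smul_smul, pow_succ, add_assoc]

end LeadingTerms

section Monomials

variable {O : Type*} [CommRing O] {n p q r : ℕ}

/-- Monomials `X ^ t` times a basis vector of a free module of rank `r` over a polynomial ring in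
`n` variables, with a monomial order. -/
abbrev Term (r n : ℕ) : Type := Fin r ×ₗ Lex (Fin n →₀ ℕ)

/-- Multiplication by the monomial `X ^ t`. -/
noncomputable def act (t : Fin n →₀ ℕ) (e : Term r n) : Term r n :=
  toLex ((ofLex e).1, toLex t + (ofLex e).2)

theorem act_strictMono (t : Fin n →₀ ℕ) : StrictMono (act t : Term r n → Term r n) := by
  intro e e' h
  rw [Prod.Lex.lt_iff] at h ⊢
  rcases h with h | ⟨h, h'⟩
  · exact Or.inl h
  · exact Or.inr ⟨h, add_lt_add_right h' (toLex t)⟩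

theorem act_act (t t' : Fin n →₀ ℕ) (e : Term r n) : act t (act t' e) = act (t + t') e := by
  simp [act, add_assoc]

theorem act_zero (e : Term r n) : act 0 e = e := by
  simp [act]

theorem exists_lt_eq_act (f : ℕ → Term r n) : ∃ i j, i < j ∧ ∃ t, f j = act t (f i) := by
  have h1 : WellQuasiOrdered (fun x y : Fin r => x = y) := Finite.wellQuasiOrdered _
  have h2 : WellQuasiOrdered (fun x y : Fin n → ℕ => x ≤ y) := wellQuasiOrdered_le
  obtain ⟨i, j, hij, h, h'⟩ := h1.prod h2 fun k => ((ofLex (f k)).1, ⇑(ofLex (ofLex (f k)).2))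
  refine ⟨i, j, hij, ofLex (ofLex (f j)).2 - ofLex (ofLex (f i)).2, ?_⟩
  have h3 : ofLex (ofLex (f j)).2 - ofLex (ofLex (f i)).2 + ofLex (ofLex (f i)).2
      = ofLex (ofLex (f j)).2 := tsub_add_cancel_of_le h'
  refine ofLex.injective (Prod.ext h.symm ?_)
  exact ofLex.injective h3.symm

/-- Dickson's lemma. -/
theorem exists_finite_generating (L : Set (Term r n)) :
    ∃ (p : ℕ) (G : Fin p → Term r n), (∀ i, G i ∈ L) ∧ ∀ e ∈ L, ∃ i t, e = act t (G i) := by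
  have key : ∃ s : Finset (Term r n), (∀ x ∈ s, x ∈ L) ∧ ∀ e ∈ L, ∃ x ∈ s, ∃ t, e = act t x := by
    by_contra! h
    obtain ⟨f, -, hf⟩ := exists_seq_of_forall_finset_exists (· ∈ L)
      (fun x y => ∀ t, y ≠ act t x) h
    obtain ⟨i, j, hij, t, ht⟩ := exists_lt_eq_act f
    exact hf i j hij t ht
  obtain ⟨s, hs, h⟩ := key
  refine ⟨s.card, fun i => (s.equivFin.symm i : Term r n), fun i => hs _ (by simp), fun e he => ?_⟩
  obtain ⟨x, hx, t, rfl⟩ := h e he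
  exact ⟨s.equivFin ⟨x, hx⟩, t, by simp⟩

theorem wellFounded_ssuperset :
    WellFounded fun L L' : {L : Set (Term r n) // ∀ e ∈ L, ∀ t, act t e ∈ L} => L'.1 ⊂ L.1 := by
  rw [wellFounded_iff_isEmpty_descending_chain]
  refine ⟨fun ⟨L, hL⟩ => ?_⟩
  have hmono : Monotone fun i => (L i).1 := monotone_nat_of_le_succ fun i => (hL i).subset
  choose f hf hf' using fun i => Set.exists_of_ssubset (hL i)
  obtain ⟨i, j, hij, t, ht⟩ := exists_lt_eq_act f
  apply hf' j
  rw [ht]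
  exact (L j).2 _ (hmono (Nat.succ_le_of_lt hij) (hf i)) t

variable (O) in
/-- Multiplication by the monomial `X ^ t` on a free module. -/
noncomputable def shift (t : Fin n →₀ ℕ) : (Term r n →₀ O) →ₗ[O] (Term r n →₀ O) :=
  Finsupp.lmapDomain O O (act t)

theorem shift_single (t : Fin n →₀ ℕ) (e : Term r n) (a : O) :
    shift O t (Finsupp.single e a) = Finsupp.single (act t e) a := by
  simp [shift]

theorem shift_apply_act (t : Fin n →₀ ℕ) (v : Term r n →₀ O) (e : Term r n) :
    shift O t v (act t e) = v e :=
  Finsupp.mapDomain_apply (act_strictMono t).injective v e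

theorem shift_shift (t t' : Fin n →₀ ℕ) (v : Term r n →₀ O) :
    shift O t (shift O t' v) = shift O (t + t') v := by
  simp only [shift, Finsupp.lmapDomain_apply, ← Finsupp.mapDomain_comp]
  congr 1
  ext1 e
  exact act_act t t' e

theorem shift_apply_mem {I : Ideal O} (t : Fin n →₀ ℕ) {v : Term r n →₀ O} {e : Term r n}
    (h : ∀ e', act t e' = e → v e' ∈ I) : shift O t v e ∈ I := by
  by_cases he : e ∈ Set.range (act t : Term r n → Term r n)
  · obtain ⟨e', rfl⟩ := he
    rw [shift_apply_act]
    exact h e' rfl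
  · rw [shift, Finsupp.lmapDomain_apply, Finsupp.mapDomain_of_notMem_range _ _ he]
    exact zero_mem _

theorem Lead.shift {I : Ideal O} {e : Term r n} {v : Term r n →₀ O} (h : Lead I e v)
    (t : Fin n →₀ ℕ) : Lead I (act t e) (shift O t v) := by
  refine ⟨by simpa [shift_apply_act] using h.1, fun e' he' => shift_apply_mem t ?_⟩
  rintro e'' rfl
  exact h.2 e'' ((act_strictMono t).lt_iff_lt.1 he')

/-- Stability under multiplication by monomials. -/
def ShiftStable (N : Submodule O (Term r n →₀ O)) : Prop :=
  ∀ t, ∀ v ∈ N, shift O t v ∈ N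

/-- The linear map sending the `i`-th basis vector of a free module over the polynomial ring
to `g i`. -/
noncomputable def gen (g : Fin q → Term r n →₀ O) : (Term q n →₀ O) →ₗ[O] (Term r n →₀ O) :=
  Finsupp.linearCombination O fun e : Term q n => shift O (ofLex (ofLex e).2) (g (ofLex e).1)

theorem gen_single (g : Fin q → Term r n →₀ O) (e : Term q n) (a : O) :
    gen g (Finsupp.single e a) = a • shift O (ofLex (ofLex e).2) (g (ofLex e).1) := by
  simp [gen]

theorem gen_shift (g : Fin q → Term r n →₀ O) (t : Fin n →₀ ℕ) (w : Term q n →₀ O) :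
    gen g (shift O t w) = shift O t (gen g w) := by
  have : gen g ∘ₗ shift O t = shift O t ∘ₗ gen g := by
    refine Finsupp.lhom_ext fun e a => ?_
    simp [shift_single, gen_single, shift_shift, act]
  exact LinearMap.congr_fun this w

theorem shiftStable_range_gen (g : Fin q → Term r n →₀ O) :
    ShiftStable (LinearMap.range (gen g)) := by
  rintro t _ ⟨w, rfl⟩
  exact ⟨shift O t w, gen_shift g t w⟩

theorem range_gen_le_iff {g : Fin q → Term r n →₀ O} {N : Submodule O (Term r n →₀ O)}
    (hN : ShiftStable N) : LinearMap.range (gen g) ≤ N ↔ ∀ i, g i ∈ N := by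
  constructor
  · intro h i
    refine h ⟨Finsupp.single (toLex (i, toLex 0)) 1, ?_⟩
    rw [gen_single]
    simp only [ofLex_toLex, one_smul, shift]
    exact (Finsupp.mapDomain_congr fun e _ => act_zero e).trans Finsupp.mapDomain_id
  · intro h
    rw [gen, Finsupp.range_linearCombination, Submodule.span_le]
    rintro _ ⟨e, rfl⟩
    exact hN _ _ (h _)

/-- Finite generation as a module over the polynomial ring. -/
def FGen (N : Submodule O (Term r n →₀ O)) : Prop :=
  ∃ (q : ℕ) (g : Fin q → Term r n →₀ O), LinearMap.range (gen g) = N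

theorem FGen.shiftStable {N : Submodule O (Term r n →₀ O)} (hN : FGen N) : ShiftStable N := by
  obtain ⟨q, g, rfl⟩ := hN
  exact shiftStable_range_gen g

theorem ShiftStable.sup {N N' : Submodule O (Term r n →₀ O)} (hN : ShiftStable N)
    (hN' : ShiftStable N') : ShiftStable (N ⊔ N') := by
  intro t v hv
  obtain ⟨x, hx, y, hy, rfl⟩ := Submodule.mem_sup.1 hv
  rw [map_add]
  exact Submodule.add_mem_sup (hN t x hx) (hN' t y hy)

theorem FGen.sup {N N' : Submodule O (Term r n →₀ O)} (hN : FGen N) (hN' : FGen N') :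
    FGen (N ⊔ N') := by
  have hs := hN.shiftStable.sup hN'.shiftStable
  obtain ⟨p, g, rfl⟩ := hN
  obtain ⟨q, g', rfl⟩ := hN'
  refine ⟨p + q, Fin.append g g', le_antisymm ((range_gen_le_iff hs).2 fun i => ?_) (sup_le ?_ ?_)⟩
  · refine Fin.addCases (fun i => ?_) (fun i => ?_) i
    · rw [Fin.append_left]
      exact Submodule.mem_sup_left ((range_gen_le_iff (shiftStable_range_gen g)).1 le_rfl i)
    · rw [Fin.append_right]
      exact Submodule.mem_sup_right ((range_gen_le_iff (shiftStable_range_gen g')).1 le_rfl i)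
  · refine (range_gen_le_iff (shiftStable_range_gen _)).2 fun i => ?_
    rw [← Fin.append_left g g' i]
    exact (range_gen_le_iff (shiftStable_range_gen _)).1 le_rfl _
  · refine (range_gen_le_iff (shiftStable_range_gen _)).2 fun i => ?_
    rw [← Fin.append_right g g' i]
    exact (range_gen_le_iff (shiftStable_range_gen _)).1 le_rfl _

variable [IsLocalRing O]

/-- The leading terms of the reduction of `N` modulo the maximal ideal. -/
def leads (N : Submodule O (Term r n →₀ O)) : Set (Term r n) :=
  {e | ∃ v ∈ N, Lead (IsLocalRing.maximalIdeal O) e v}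

theorem leads_mono {N N' : Submodule O (Term r n →₀ O)} (h : N ≤ N') : leads N ⊆ leads N' :=
  fun _ ⟨v, hv, hv'⟩ => ⟨v, h hv, hv'⟩

theorem ShiftStable.act_mem_leads {N : Submodule O (Term r n →₀ O)} (hN : ShiftStable N) :
    ∀ e ∈ leads N, ∀ t, act t e ∈ leads N :=
  fun _ ⟨v, hv, hv'⟩ t => ⟨shift O t v, hN t v hv, hv'.shift t⟩

theorem mem_leads_of_not_mem {N : Submodule O (Term r n →₀ O)} {v : Term r n →₀ O} (hv : v ∈ N)
    {e : Term r n} (he : v e ∉ IsLocalRing.maximalIdeal O)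
    (h : ∀ e' > e, v e' ∈ IsLocalRing.maximalIdeal O) : e ∈ leads N := by
  obtain ⟨c, hc⟩ := exists_lead_smul he h
  exact ⟨c • v, N.smul_mem c hv, hc⟩

variable [PreValuationRing O]

theorem exists_finite_lead (N : Submodule O (Term r n →₀ O)) :
    ∃ (p : ℕ) (G : Fin p → Term r n) (v : Fin p → Term r n →₀ O),
      ∃ d ∈ IsLocalRing.maximalIdeal O, (∀ i, v i ∈ N) ∧ (∀ i, Lead (Ideal.span {d}) (G i) (v i)) ∧
        ∀ e ∈ leads N, ∃ i t, e = act t (G i) := by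
  obtain ⟨p, G, hG, hG'⟩ := exists_finite_generating (leads N)
  choose v hv hv' using hG
  choose c hc hc' using fun i => (hv' i).exists_span
  obtain ⟨d, hd, hdc⟩ := exists_mem_maximalIdeal_forall_dvd Finset.univ c fun i _ => hc i
  exact ⟨p, G, v, d, hd, hv, fun i => (hc' i).span_mono (hdc i (Finset.mem_univ i)), hG'⟩

omit [IsLocalRing O] [PreValuationRing O] in
/-- A finite family of monic vectors extends to a family of monic vectors. -/
theorem exists_lead_extension {L : Set (Term r n)} {G : Fin p → Term r n}
    {v : Fin p → Term r n →₀ O} {d : O} (hv : ∀ i, Lead (Ideal.span {d}) (G i) (v i))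
    (hL : ∀ e ∈ L, ∃ i t, e = act t (G i)) :
    ∃ f : Term r n → Term r n →₀ O, (∀ e, Lead (Ideal.span {d}) e (f e)) ∧
      (∀ e ∈ L, ∃ i t, f e = shift O t (v i)) ∧ ∀ e ∉ L, f e = Finsupp.single e 1 := by
  have key : ∀ e, ∃ x : Term r n →₀ O, Lead (Ideal.span {d}) e x ∧
      (e ∈ L → ∃ i t, x = shift O t (v i)) ∧ (e ∉ L → x = Finsupp.single e 1) := by
    intro e
    by_cases he : e ∈ L
    · obtain ⟨i, t, rfl⟩ := hL e he
      exact ⟨shift O t (v i), (hv i).shift t, fun _ => ⟨i, t, rfl⟩, fun h => absurd he h⟩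
    · exact ⟨Finsupp.single e 1, lead_single _ e, fun h => absurd h he, fun _ => rfl⟩
  choose f h h' h'' using key
  exact ⟨f, h, h', h''⟩

theorem ShiftStable.exists_lead_family {N : Submodule O (Term r n →₀ O)} (hN : ShiftStable N) :
    ∃ d ∈ IsLocalRing.maximalIdeal O, ∃ f : Term r n → Term r n →₀ O,
      (∀ e, Lead (Ideal.span {d}) e (f e)) ∧ (∀ e ∈ leads N, f e ∈ N) ∧
        ∀ e ∉ leads N, f e = Finsupp.single e 1 := by
  obtain ⟨p, G, v, d, hd, hvN, hv, hG⟩ := exists_finite_lead N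
  obtain ⟨f, hf, hf', hf''⟩ := exists_lead_extension hv hG
  refine ⟨d, hd, f, hf, fun e he => ?_, hf''⟩
  obtain ⟨i, t, h⟩ := hf' e he
  rw [h]
  exact hN _ _ (hvN i)

end Monomials

section Step

variable {O : Type*} [CommRing O] {n p q r : ℕ}

theorem linearCombination_mem {E V : Type*} [AddCommGroup V] [Module O V] {N : Submodule O V}
    {f : E → V} {a : E →₀ O} (h : ∀ e, a e ≠ 0 → f e ∈ N) :
    Finsupp.linearCombination O f a ∈ N := by
  rw [Finsupp.linearCombination_apply]
  exact N.sum_mem fun e he => N.smul_mem _ (h e (Finsupp.mem_support_iff.1 he))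

theorem linearCombination_congr {E V : Type*} [AddCommGroup V] [Module O V]
    {f g : E → V} {a : E →₀ O} (h : ∀ e, a e ≠ 0 → f e = g e) :
    Finsupp.linearCombination O f a = Finsupp.linearCombination O g a := by
  rw [Finsupp.linearCombination_apply, Finsupp.linearCombination_apply]
  exact Finsupp.sum_congr fun e he => by rw [h e (Finsupp.mem_support_iff.1 he)]

theorem linearCombination_single_one {E : Type*} (a : E →₀ O) :
    Finsupp.linearCombination O (fun e => Finsupp.single e (1 : O)) a = a := by
  simp [Finsupp.linearCombination_apply]

theorem exists_split {E : Type*} (L : Set E) (a : E →₀ O) :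
    ∃ b c : E →₀ O, a = b + c ∧ (∀ e, b e ≠ 0 → e ∈ L) ∧ (∀ e, c e ≠ 0 → e ∉ L) ∧
      ∀ e ∉ L, a e = c e := by
  classical
  refine ⟨a.filter (· ∈ L), a.filter (· ∉ L), (Finsupp.filter_add_filter_not a _).symm,
    fun e he => ?_, fun e he => ?_, fun e he => (Finsupp.filter_apply_pos _ a he).symm⟩
  · by_contra h
    exact he (Finsupp.filter_apply_neg _ a h)
  · by_contra h
    exact he (Finsupp.filter_apply_neg _ a (not_not.2 h))

/-- The approximate syzygies: combinations of the generators vanishing modulo `I`. -/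
def approxSyz (I : Ideal O) (g : Fin q → Term r n →₀ O) : Submodule O (Term q n →₀ O) where
  carrier := {w | ∀ e, gen g w e ∈ I}
  add_mem' h h' e := by simpa using I.add_mem (h e) (h' e)
  zero_mem' e := by simp
  smul_mem' c w h e := by simpa using I.mul_mem_left c (h e)

variable [IsDomain O] [ValuationRing O] {π : O}

/-- An approximate syzygy can be corrected so that its value avoids the leading terms. -/
theorem exists_reduced_syzygy (harch : ∀ d ∈ IsLocalRing.maximalIdeal O, ∃ s : ℕ, π ∣ d ^ s)
    {g : Fin q → Term r n →₀ O} (hπN : ∀ v, π • v ∈ LinearMap.range (gen g))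
    {w : Term q n →₀ O} (hw : w ∈ approxSyz (IsLocalRing.maximalIdeal O) g) :
    ∃ c ∈ IsLocalRing.maximalIdeal O, ∃ a : Term q n →₀ O,
      ∀ e ∈ leads (LinearMap.range (gen g)), gen g (w - c • a) e = 0 := by
  obtain ⟨c, hc, x, hx⟩ := exists_mem_maximalIdeal_eq_smul hw
  obtain ⟨d, hd, f, hf, hfN, hf1⟩ := (shiftStable_range_gen g).exists_lead_family
  obtain ⟨s, hs⟩ := harch d hd
  obtain ⟨a, y, hay⟩ := exists_linearCombination_add_smul_of_dvd_pow hs hf x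
  obtain ⟨b, b', rfl, hb, hb', -⟩ := exists_split (leads (LinearMap.range (gen g))) a
  obtain ⟨z, hz⟩ : Finsupp.linearCombination O f b + π • y ∈ LinearMap.range (gen g) :=
    Submodule.add_mem _ (linearCombination_mem fun e he => hfN e (hb e he)) (hπN y)
  refine ⟨c, hc, z, fun e he => ?_⟩
  have h : gen g (w - c • z) = c • b' := by
    have h' : Finsupp.linearCombination O f b' = b' := by
      rw [linearCombination_congr fun e he => hf1 e (hb' e he), linearCombination_single_one]
    rw [map_sub, map_smul, hz, hx, hay, map_add, h', ← smul_sub]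
    congr 1
    abel
  have h0 : b' e = 0 := by
    by_contra h0
    exact hb' e h0 he
  simp [h, h0]

/-- Generators of the approximate syzygies control the elements of `N` divisible by `c ∣ ε`. -/
theorem exists_eq_smul_add_of_gen_eq_smul
    (harch : ∀ d ∈ IsLocalRing.maximalIdeal O, ∃ s : ℕ, π ∣ d ^ s)
    {g : Fin q → Term r n →₀ O} {U : Submodule O (Term r n →₀ O)} {ε d : O} (hε : ε ∣ π)
    (hd : d ∈ IsLocalRing.maximalIdeal O) {f : Term q n → Term q n →₀ O}
    (hf : ∀ e, Lead (Ideal.span {d}) e (f e))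
    (hfU : ∀ e ∈ leads (approxSyz (IsLocalRing.maximalIdeal O) g), ∃ y ∈ U, gen g (f e) = ε • y)
    (hf1 : ∀ e ∉ leads (approxSyz (IsLocalRing.maximalIdeal O) g), f e = Finsupp.single e 1)
    {c : O} (hc : c ∣ ε) {a : Term q n →₀ O} {x : Term r n →₀ O} (hax : gen g a = c • x) :
    ∃ y ∈ U, ∃ w, gen g a = ε • y + c • gen g w := by
  obtain ⟨s, hs⟩ := harch d hd
  obtain ⟨l, w, hlw⟩ := exists_linearCombination_add_smul_of_dvd_pow ((hc.trans hε).trans hs) hf a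
  obtain ⟨b, b', rfl, hb, hb', -⟩ :=
    exists_split (leads (approxSyz (IsLocalRing.maximalIdeal O) g)) l
  have h1 : Finsupp.linearCombination O f b ∈
      (U.map (ε • LinearMap.id : (Term r n →₀ O) →ₗ[O] _)).comap (gen g) := by
    refine linearCombination_mem fun e he => ?_
    obtain ⟨y, hy, h⟩ := hfU e (hb e he)
    exact ⟨y, hy, by simpa using h.symm⟩
  obtain ⟨y, hy, hby⟩ := h1
  have h2 : Finsupp.linearCombination O f b' = b' := by
    rw [linearCombination_congr fun e he => hf1 e (hb' e he), linearCombination_single_one]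
  rw [map_add, h2] at hlw
  obtain ⟨ε', rfl⟩ := hc
  have h3 : gen g a = (c * ε') • y + gen g b' + c • gen g w := by
    rw [hlw, map_add, map_add, map_smul, ← hby]
    simp
  suffices h : ∃ h : Term q n →₀ O, b' = c • h by
    obtain ⟨h, hh⟩ := h
    refine ⟨y, hy, h + w, ?_⟩
    rw [h3, hh, map_smul, map_add, smul_add, add_assoc]
  by_cases hb0 : b' = 0
  · exact ⟨0, by simpa using hb0⟩
  obtain ⟨e₀, he₀, h, hh, hh1, hh0⟩ := exists_content hb0
  generalize b' e₀ = k at hh he₀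
  by_cases hck : c ∣ k
  · obtain ⟨k', rfl⟩ := hck
    exact ⟨k' • h, by rw [hh, mul_smul]⟩
  exfalso
  obtain ⟨m, rfl⟩ := (ValuationRing.dvd_total c k).resolve_left hck
  have hm : m ∈ IsLocalRing.maximalIdeal O := by
    rw [IsLocalRing.mem_maximalIdeal]
    exact fun hu => hck (hu.mul_right_dvd.2 dvd_rfl)
  have h4 : gen g h = m • (x - ε' • y - gen g w) := by
    refine smul_right_injective _ he₀ ?_
    have : k • gen g h = gen g b' := by rw [hh, map_smul]
    simp only
    rw [this, smul_smul, smul_sub, smul_sub, ← hax, h3, mul_smul (k * m) ε']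
    abel
  have h5 : h ∈ approxSyz (IsLocalRing.maximalIdeal O) g := by
    intro e
    rw [h4]
    exact Ideal.mul_mem_right _ _ hm
  obtain ⟨e, he, he'⟩ := exists_lead_of_not_mem (v := h) (e := e₀) (by simp [hh1])
  exact he (by rw [hh0 e (by
    by_contra h0
    exact hb' e h0 (mem_leads_of_not_mem h5 he he'))]; exact zero_mem _)

theorem exists_saturation_step (harch : ∀ d ∈ IsLocalRing.maximalIdeal O, ∃ s : ℕ, π ∣ d ^ s)
    (hπ : π ≠ 0) {N : Submodule O (Term r n →₀ O)} (hN : FGen N) (hπN : ∀ v, π • v ∈ N)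
    (hL : leads N ≠ Set.univ) :
    ∃ ε : O, ε ≠ 0 ∧ ∃ N' : Submodule O (Term r n →₀ O), (∀ v, v ∈ N' ↔ ε • v ∈ N) ∧ FGen N' ∧
      leads N ⊂ leads N' ∧ ∀ c v, c • v ∈ N → c ∣ ε → ¬ ε ∣ c →
        ∃ x ∈ N, ∀ e, (v - x) e ∈ IsLocalRing.maximalIdeal O := by
  classical
  have hNs := hN.shiftStable
  obtain ⟨q, g, rfl⟩ := hN
  obtain ⟨p, G, S, d₁, hd₁, hS, hSl, hG⟩ :=
    exists_finite_lead (approxSyz (IsLocalRing.maximalIdeal O) g)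
  choose c hc a ha using fun i => exists_reduced_syzygy harch hπN (hS i)
  obtain ⟨d₂, hd₂, hd₂c⟩ := exists_mem_maximalIdeal_forall_dvd Finset.univ c fun i _ => hc i
  obtain ⟨d, hd, hdd₁, hdd₂⟩ : ∃ d ∈ IsLocalRing.maximalIdeal O, d ∣ d₁ ∧ d ∣ d₂ := by
    rcases ValuationRing.dvd_total d₁ d₂ with h | h
    · exact ⟨d₁, hd₁, dvd_rfl, h⟩
    · exact ⟨d₂, hd₂, h, dvd_rfl⟩
  have hdc : ∀ i x, c i * x ∈ Ideal.span {d} := fun i x => Ideal.mem_span_singleton.2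
    ((hdd₂.trans (hd₂c i (Finset.mem_univ i))).trans (dvd_mul_right _ _))
  have hS' : ∀ i, Lead (Ideal.span {d}) (G i) (S i - c i • a i) := by
    intro i
    have h := (hSl i).span_mono hdd₁
    refine ⟨?_, fun e he => ?_⟩
    · rw [Finsupp.sub_apply, Finsupp.smul_apply, smul_eq_mul, sub_right_comm]
      exact Ideal.sub_mem _ h.1 (hdc _ _)
    · exact Ideal.sub_mem _ (h.2 e he) (hdc _ _)
  obtain ⟨f, hf, hfS, hf1⟩ := exists_lead_extension hS' hG
  obtain ⟨ε, hεmem, hε⟩ := exists_mem_forall_dvd (s := insert π (Finset.univ.biUnion fun i =>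
    (gen g (S i - c i • a i)).support.image (gen g (S i - c i • a i))))
    (Finset.insert_nonempty _ _) id
  have hεπ : ε ∣ π := hε π (Finset.mem_insert_self _ _)
  have hε0 : ε ≠ 0 := fun h => hπ (zero_dvd_iff.1 (h ▸ hεπ))
  have hεS : ∀ i e, ε ∣ gen g (S i - c i • a i) e := by
    intro i e
    by_cases h : gen g (S i - c i • a i) e = 0
    · rw [h]
      exact dvd_zero _
    · exact hε _ (Finset.mem_insert_of_mem (Finset.mem_biUnion.2 ⟨i, Finset.mem_univ i,
        Finset.mem_image_of_mem _ (Finsupp.mem_support_iff.2 h)⟩))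
  choose u hu hu0 using fun i => exists_eq_smul_of_forall_dvd (hεS i)
  have hC := fun {c} (hc : c ∣ ε) {a x} => exists_eq_smul_add_of_gen_eq_smul (c := c) (a := a)
    (x := x) harch (U := LinearMap.range (gen u)) hεπ hd hf (fun e he => by
      obtain ⟨i, t, h⟩ := hfS e he
      refine ⟨shift O t (u i), shiftStable_range_gen u t _
        ((range_gen_le_iff (shiftStable_range_gen u)).1 le_rfl i), ?_⟩
      rw [h, gen_shift, hu, map_smul]) hf1 hc
  have huN : ∀ y ∈ LinearMap.range (gen u), ε • y ∈ LinearMap.range (gen g) := by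
    have : LinearMap.range (gen u) ≤
        (LinearMap.range (gen g)).comap (ε • LinearMap.id : (Term r n →₀ O) →ₗ[O] _) := by
      rw [range_gen_le_iff]
      · intro i
        exact ⟨_, hu i⟩
      · intro t v hv
        have := hNs t _ hv
        simpa using this
    exact fun y hy => by simpa using this hy
  have hmem : ∀ v, v ∈ LinearMap.range (gen g) ⊔ LinearMap.range (gen u) ↔
      ε • v ∈ LinearMap.range (gen g) := by
    intro v
    constructor
    · intro h
      obtain ⟨x, hx, y, hy, rfl⟩ := Submodule.mem_sup.1 h
      rw [smul_add]
      exact Submodule.add_mem _ (Submodule.smul_mem _ _ hx) (huN y hy)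
    · rintro ⟨b, hb⟩
      obtain ⟨y, hy, w, h⟩ := hC dvd_rfl hb
      rw [hb, ← smul_add] at h
      rw [smul_right_injective _ hε0 h, add_comm]
      exact Submodule.add_mem_sup ⟨w, rfl⟩ hy
  refine ⟨ε, hε0, LinearMap.range (gen g) ⊔ LinearMap.range (gen u), hmem,
    FGen.sup ⟨_, _, rfl⟩ ⟨_, _, rfl⟩, (leads_mono le_sup_left).ssubset_of_not_subset ?_, ?_⟩
  · intro hsub
    rcases Finset.mem_insert.1 hεmem with rfl | h
    · refine hL (Set.eq_univ_of_forall fun e => hsub ⟨Finsupp.single e 1, ?_, lead_single _ e⟩)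
      exact (hmem _).2 (hπN _)
    · obtain ⟨i, -, h⟩ := Finset.mem_biUnion.1 h
      obtain ⟨e, -, h⟩ := Finset.mem_image.1 h
      have hue : u i e = 1 := by
        rw [hu i, Finsupp.smul_apply, smul_eq_mul] at h
        exact mul_left_cancel₀ hε0 (by rw [h, mul_one])
      obtain ⟨e', he', he''⟩ := exists_lead_of_not_mem (v := u i) (e := e) (by simp [hue])
      have huN' : u i ∈ LinearMap.range (gen g) ⊔ LinearMap.range (gen u) :=
        Submodule.mem_sup_right ((range_gen_le_iff (shiftStable_range_gen u)).1 le_rfl i)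
      have := hu0 i e' (ha i e' (hsub (mem_leads_of_not_mem huN' he' he'')))
      exact he' (this ▸ zero_mem _)
  · rintro k v ⟨b, hb⟩ hk hk'
    obtain ⟨y, hy, w, h⟩ := hC hk hb
    obtain ⟨m, rfl⟩ := hk
    have hm : m ∈ IsLocalRing.maximalIdeal O := by
      rw [IsLocalRing.mem_maximalIdeal]
      exact fun hu => hk' (hu.mul_right_dvd.2 dvd_rfl)
    refine ⟨gen g w, ⟨w, rfl⟩, fun e => ?_⟩
    rw [hb, mul_smul, ← smul_add] at h
    rw [smul_right_injective _ (left_ne_zero_of_mul hε0) h, add_sub_cancel_right]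
    exact Ideal.mul_mem_right _ _ hm

theorem exists_adapted_family (harch : ∀ d ∈ IsLocalRing.maximalIdeal O, ∃ s : ℕ, π ∣ d ^ s)
    (hπ : π ≠ 0) {N : Submodule O (Term r n →₀ O)} (hN : FGen N) (hπN : ∀ v, π • v ∈ N) :
    ∃ (f : Term r n → Term r n →₀ O) (δ : Term r n → O), ∃ d ∈ IsLocalRing.maximalIdeal O,
      (∀ e, Lead (Ideal.span {d}) e (f e)) ∧ (Set.range δ).Finite ∧ (∀ e, δ e ≠ 0) ∧
        (∀ e, δ e • f e ∈ N) ∧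
          ∀ a, Finsupp.linearCombination O f a ∈ N → ∀ e, δ e ∣ a e := by
  classical
  obtain ⟨L, hL⟩ : ∃ L : {L : Set (Term r n) // ∀ e ∈ L, ∀ t, act t e ∈ L}, L.1 = leads N :=
    ⟨⟨leads N, hN.shiftStable.act_mem_leads⟩, rfl⟩
  induction L using wellFounded_ssuperset.induction generalizing N with
  | _ L ih =>
  obtain ⟨d₁, hd₁, f₁, hf₁, hf₁N, -⟩ := hN.shiftStable.exists_lead_family
  by_cases hLu : leads N = Set.univ
  · refine ⟨f₁, fun _ => 1, d₁, hd₁, hf₁,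
      Set.finite_range_const, by simp, fun e => ?_, by simp⟩
    rw [one_smul]
    exact hf₁N e (by simp [hLu])
  obtain ⟨ε, hε, N', hN', hN'g, hlt, hflat⟩ := exists_saturation_step harch hπ hN hπN hLu
  obtain ⟨f₂, δ, d₂, hd₂, hf₂, hδ, hδ0, hδf, hδa⟩ :=
    ih ⟨leads N', hN'g.shiftStable.act_mem_leads⟩ (by simpa [hL] using hlt) hN'g
      (fun v => (hN' _).2 (N.smul_mem _ (hπN v))) rfl
  obtain ⟨d, hd, hdd₁, hdd₂⟩ : ∃ d ∈ IsLocalRing.maximalIdeal O, d ∣ d₁ ∧ d ∣ d₂ := by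
    rcases ValuationRing.dvd_total d₁ d₂ with h | h
    · exact ⟨d₁, hd₁, dvd_rfl, h⟩
    · exact ⟨d₂, hd₂, h, dvd_rfl⟩
  refine ⟨fun e => if e ∈ leads N then f₁ e else f₂ e, fun e => if e ∈ leads N then 1 else ε * δ e,
    d, hd, fun e => ?_, ?_, fun e => ?_, fun e => ?_, fun a ha e => ?_⟩
  · by_cases he : e ∈ leads N
    · simpa [he] using (hf₁ e).span_mono hdd₁
    · simpa [he] using (hf₂ e).span_mono hdd₂
  · refine ((hδ.image (ε * ·)).insert 1).subset ?_
    rintro _ ⟨e, rfl⟩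
    by_cases he : e ∈ leads N
    · simp [he]
    · exact Or.inr ⟨δ e, ⟨e, rfl⟩, by simp [he]⟩
  · by_cases he : e ∈ leads N <;> simp [he, hε, hδ0]
  · by_cases he : e ∈ leads N
    · simpa [he] using hf₁N e he
    · simpa [he, mul_smul] using (hN' _).1 (hδf e)
  by_cases he : e ∈ leads N
  · simp [he]
  obtain ⟨b, b', rfl, hb, hb', hab⟩ := exists_split (leads N) a
  have hb'N : Finsupp.linearCombination O f₂ b' ∈ N := by
    rw [map_add] at ha
    have h := (N.add_mem_iff_right (linearCombination_mem fun e he => by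
      simpa [hb e he] using hf₁N e (hb e he))).1 ha
    rwa [linearCombination_congr fun e he => if_neg (hb' e he)] at h
  simp only [if_neg he]
  rw [hab e he]
  by_cases hb0 : b' = 0
  · simp [hb0]
  obtain ⟨e₀, he₀, h, hh, hh1, hh0⟩ := exists_content hb0
  generalize b' e₀ = k at hh he₀
  by_cases hεk : ε ∣ k
  · obtain ⟨k, rfl⟩ := hεk
    rw [hh, mul_smul, map_smul, ← hN'] at hb'N
    rw [hh, mul_smul, Finsupp.smul_apply, smul_eq_mul]
    exact mul_dvd_mul_left ε (hδa _ hb'N e)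
  exfalso
  rw [hh, map_smul] at hb'N
  obtain ⟨x, hx, hxm⟩ := hflat k _ hb'N ((ValuationRing.dvd_total ε k).resolve_left hεk) hεk
  obtain ⟨e₁, he₁, he₁'⟩ := exists_lead_of_not_mem (v := h) (e := e₀) (by simp [hh1])
  obtain ⟨h1, h2⟩ := linearCombination_lead (I := IsLocalRing.maximalIdeal O)
    (fun e => (hf₂ e).mono ((Ideal.span_singleton_le_iff_mem _).2 hd₂)) he₁'
  have h3 : e₁ ∈ leads N := by
    refine mem_leads_of_not_mem hx (fun h3 => he₁ ?_) fun e' he' => ?_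
    · have := Ideal.sub_mem _ (Ideal.add_mem _ (hxm e₁) h3) h1
      simpa using this
    · have := Ideal.sub_mem _ (h2 e' he') (hxm e')
      simpa using this
  refine he₁ ?_
  rw [hh0 e₁ (by_contra fun h0 => hb' e₁ h0 h3)]
  exact zero_mem _

end Step

section Decomposition

theorem exists_cyclic_decomposition {O : Type} [CommRing O] [IsLocalRing O] {E : Type} [Countable E]
    {M : Type*} [AddCommGroup M] [Module O M] {φ : (E →₀ O) →ₗ[O] M}
    (hφ : Function.Surjective φ) {δ : E → O} (hδ : (Set.range δ).Finite) (hδ0 : ∀ e, δ e ≠ 0)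
    (hker : ∀ a, φ a = 0 ↔ ∀ e, δ e ∣ a e) :
    ∃ (k : ℕ) (πs : Fin k → O) (I : Fin k → Type),
      (∀ i, πs i ∈ IsLocalRing.maximalIdeal O) ∧
      (∀ i, πs i ≠ 0) ∧
      (∀ i, Countable (I i)) ∧
      Nonempty (M ≃ₗ[O] ((i : Fin k) → (I i →₀ O ⧸ Ideal.span {πs i}))) := by
  classical
  obtain ⟨k, πs, hinj, hrange⟩ :=
    (hδ.subset (Set.inter_subset_left (t := {x | x ∈ IsLocalRing.maximalIdeal O}))).fin_param
  have hπs : ∀ i, πs i ∈ Set.range δ ∩ {x | x ∈ IsLocalRing.maximalIdeal O} :=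
    fun i => hrange ▸ Set.mem_range_self i
  let ψ : (E →₀ O) →ₗ[O] ((i : Fin k) → ({e // δ e = πs i} →₀ O ⧸ Ideal.span {πs i})) :=
    LinearMap.pi fun i =>
      (Finsupp.mapRange.linearMap (Ideal.Quotient.mkₐ O (Ideal.span {πs i})).toLinearMap) ∘ₗ
        Finsupp.lsubtypeDomain {e | δ e = πs i}
  have hψ_apply : ∀ a i (e : {e // δ e = πs i}),
      ψ a i e = Ideal.Quotient.mk (Ideal.span {πs i}) (a e) := fun a i e => rfl
  have hψker : ∀ a, ψ a = 0 ↔ ∀ e, δ e ∣ a e := by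
    intro a
    constructor
    · intro h e
      by_cases he : δ e ∈ IsLocalRing.maximalIdeal O
      · obtain ⟨i, hi⟩ : δ e ∈ Set.range πs := by rw [hrange]; exact ⟨⟨e, rfl⟩, he⟩
        have h' := hψ_apply a i ⟨e, hi.symm⟩
        rw [h] at h'
        rw [← hi, ← Ideal.mem_span_singleton]
        exact Ideal.Quotient.eq_zero_iff_mem.1 h'.symm
      · exact (IsLocalRing.notMem_maximalIdeal.1 he).dvd
    · intro h
      funext i
      ext ⟨e, he⟩
      rw [hψ_apply]
      have h' := h e
      rw [show δ e = πs i from he] at h'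
      exact Ideal.Quotient.eq_zero_iff_mem.2 (Ideal.mem_span_singleton.2 h')
  have hψ : Function.Surjective ψ := by
    intro y
    choose b hb using fun i => Finsupp.mapRange_surjective (α := {e // δ e = πs i})
      (Ideal.Quotient.mk (Ideal.span {πs i})) (map_zero _) Ideal.Quotient.mk_surjective (y i)
    refine ⟨∑ i, (b i).extendDomain, ?_⟩
    funext i
    ext ⟨e, he⟩
    rw [hψ_apply, ← hb i, Finsupp.mapRange_apply, Finsupp.finsetSum_apply,
      Finset.sum_eq_single i]
    · simp [Finsupp.extendDomain_apply, he]
    · intro j _ hj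
      have : δ e ≠ πs j := fun h => hj (hinj (h.symm.trans he))
      simp [Finsupp.extendDomain_apply, this]
    · simp
  have hkers : LinearMap.ker φ = LinearMap.ker ψ := by
    ext a
    rw [LinearMap.mem_ker, LinearMap.mem_ker, hker, hψker]
  refine ⟨k, πs, fun i => {e // δ e = πs i}, fun i => (hπs i).2, fun i => ?_,
    fun i => inferInstance, ⟨?_⟩⟩
  · obtain ⟨e, he⟩ := (hπs i).1
    exact he ▸ hδ0 e
  · exact (φ.quotKerEquivOfSurjective hφ).symm ≪≫ₗ Submodule.quotEquivOfEq _ _ hkers ≪≫ₗ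
      ψ.quotKerEquivOfSurjective hψ

variable (O : Type*) [CommRing O] (n r : ℕ)

/-- The basis of a finite free module over a polynomial ring given by monomials. -/
noncomputable def termBasis : Module.Basis (Term r n) O (Fin r → MvPolynomial (Fin n) O) :=
  (Pi.basis fun _ : Fin r => MvPolynomial.basisMonomials (Fin n) O).reindex
    ((Equiv.sigmaEquivProd (Fin r) (Fin n →₀ ℕ)).trans
      ((Equiv.prodCongr (Equiv.refl _) toLex).trans toLex))

variable {O n r}

theorem termBasis_apply (e : Term r n) :
    termBasis O n r e = Pi.single (ofLex e).1 (MvPolynomial.monomial (ofLex (ofLex e).2) 1) := by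
  simp [termBasis, Pi.basis_apply]

theorem termBasis_repr_symm_shift (t : Fin n →₀ ℕ) (v : Term r n →₀ O) :
    (termBasis O n r).repr.symm (shift O t v) =
      MvPolynomial.monomial t (1 : O) • (termBasis O n r).repr.symm v := by
  induction v using Finsupp.induction_linear with
  | zero => simp
  | add v w hv hw => rw [map_add, map_add, hv, hw, map_add, smul_add]
  | single e a =>
    rw [shift_single, Module.Basis.repr_symm_single, Module.Basis.repr_symm_single,
      termBasis_apply, termBasis_apply, smul_comm (MvPolynomial.monomial t (1 : O)) a]
    congr 1
    rw [← Pi.single_smul, smul_eq_mul, MvPolynomial.monomial_mul, mul_one]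
    simp only [act, ofLex_toLex]
    rfl

theorem termBasis_repr_monomial_smul (t : Fin n →₀ ℕ) (a : O)
    (x : Fin r → MvPolynomial (Fin n) O) :
    (termBasis O n r).repr (MvPolynomial.monomial t a • x) =
      a • shift O t ((termBasis O n r).repr x) := by
  apply (termBasis O n r).repr.symm.injective
  rw [LinearEquiv.map_smul _ a, termBasis_repr_symm_shift, LinearEquiv.symm_apply_apply,
    LinearEquiv.symm_apply_apply, ← smul_assoc, MvPolynomial.smul_monomial, smul_eq_mul, mul_one]

theorem fGen_comap_restrictScalars {K : Submodule (MvPolynomial (Fin n) O)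
    (Fin r → MvPolynomial (Fin n) O)} (hK : K.FG) :
    FGen ((K.restrictScalars O).comap (termBasis O n r).repr.symm.toLinearMap) := by
  obtain ⟨q, g, rfl⟩ := Submodule.fg_iff_exists_fin_generating_family.1 hK
  refine ⟨q, fun i => (termBasis O n r).repr (g i), le_antisymm ?_ fun v hv => ?_⟩
  · refine (range_gen_le_iff ?_).2 fun i => ?_
    · intro t v hv
      have h := Submodule.smul_mem (Submodule.span _ (Set.range g))
        (MvPolynomial.monomial t (1 : O)) hv
      exact (congrArg (· ∈ Submodule.span _ (Set.range g)) (termBasis_repr_symm_shift t v)).mpr h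
    · simpa using Submodule.subset_span (Set.mem_range_self i)
  · set N := LinearMap.range (gen fun i => (termBasis O n r).repr (g i)) with hN
    have hNs : ShiftStable N := shiftStable_range_gen _
    suffices h : ∀ x ∈ Submodule.span (MvPolynomial (Fin n) O) (Set.range g),
        (termBasis O n r).repr x ∈ N by
      simpa using h _ hv
    intro x hx
    induction hx using Submodule.span_induction with
    | mem x hx =>
      obtain ⟨i, rfl⟩ := hx
      exact (range_gen_le_iff hNs).1 le_rfl i
    | zero => simp
    | add x y _ _ hx hy =>
      rw [map_add]
      exact N.add_mem hx hy
    | smul p x _ hx =>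
      induction p using MvPolynomial.induction_on' with
      | monomial t a =>
        rw [termBasis_repr_monomial_smul]
        exact N.smul_mem _ (hNs _ _ hx)
      | add p p' hp hp' =>
        rw [add_smul, map_add]
        exact N.add_mem hp hp'

theorem exists_cyclic_decomposition_of_finitePresentation {O : Type} [CommRing O] [IsDomain O]
    [ValuationRing O] {π : O} (hπ : π ≠ 0)
    (harch : ∀ d ∈ IsLocalRing.maximalIdeal O, ∃ s : ℕ, π ∣ d ^ s)
    (M : Type*) [AddCommGroup M] [Module O M] [Module (MvPolynomial (Fin n) O) M]
    [IsScalarTower O (MvPolynomial (Fin n) O) M]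
    [Module.FinitePresentation (MvPolynomial (Fin n) O) M] (hM : ∀ x : M, π • x = 0) :
    ∃ (k : ℕ) (πs : Fin k → O) (I : Fin k → Type),
      (∀ i, πs i ∈ IsLocalRing.maximalIdeal O) ∧
      (∀ i, πs i ≠ 0) ∧
      (∀ i, Countable (I i)) ∧
      Nonempty (M ≃ₗ[O] ((i : Fin k) → (I i →₀ O ⧸ Ideal.span {πs i}))) := by
  obtain ⟨r, p, hp⟩ := Module.Finite.exists_fin' (MvPolynomial (Fin n) O) M
  have hK := Module.FinitePresentation.fg_ker p hp
  let Φ : (Term r n →₀ O) →ₗ[O] M := p.restrictScalars O ∘ₗ (termBasis O n r).repr.symm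
  have hΦ : Function.Surjective Φ := hp.comp (termBasis O n r).repr.symm.surjective
  have hN : FGen (LinearMap.ker Φ) := fGen_comap_restrictScalars hK
  obtain ⟨f, δ, d, hd, hf, hδ, hδ0, hδf, hδa⟩ := exists_adapted_family harch hπ hN
    (fun v => by rw [LinearMap.mem_ker, map_smul, hM])
  obtain ⟨s, hs⟩ := harch d hd
  have : Countable (Term r n) := inferInstanceAs (Countable (Fin r × (Fin n →₀ ℕ)))
  refine exists_cyclic_decomposition (φ := Φ ∘ₗ Finsupp.linearCombination O f) (fun x => ?_) hδ hδ0
    fun a => ⟨fun h => hδa a h, fun h => ?_⟩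
  · obtain ⟨v, rfl⟩ := hΦ x
    obtain ⟨a, w, rfl⟩ := exists_linearCombination_add_smul_of_dvd_pow hs hf v
    exact ⟨a, by simp [hM]⟩
  · refine LinearMap.mem_ker.1 ?_
    rw [LinearMap.ker_comp, Submodule.mem_comap, Finsupp.linearCombination_apply]
    refine Submodule.sum_mem _ fun e _ => ?_
    obtain ⟨c, hc⟩ := h e
    simp only [hc]
    rw [mul_comm, mul_smul]
    exact Submodule.smul_mem _ _ (hδf e)

end Decomposition

end TorsionStructure

/-- Let `O` be a valuation ring of rank at most one (its value group
embeds into the reals, stated here multiplicatively: the value group embeds into `ℝ≥0`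
by a strictly monotone homomorphism of monoids with zero).  Let `π` be a nonzero element
of the maximal ideal, `A` a finitely presented algebra over `O/(π)` and `M` a finitely
presented `A`-module.  Then, as an `O`-module, `M` decomposes as a direct sum
`⊕_{i=1}^{k} (O/(π_i))^{(I_i)}` for some nonzero `π₁, …, π_k` in the maximal ideal and
some finite or countable index types `I₁, …, I_k`. -/
theorem torsion_structure
    (O : Type) [CommRing O] [IsDomain O] [ValuationRing O]
    (hrank : ∃ f : ValuationRing.ValueGroup O (FractionRing O) →*₀ NNReal, StrictMono f)
    (π : O) (hπmem : π ∈ IsLocalRing.maximalIdeal O) (hπne : π ≠ 0)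
    (A : Type) [CommRing A] [Algebra (O ⧸ Ideal.span {π}) A]
    [Algebra.FinitePresentation (O ⧸ Ideal.span {π}) A]
    (M : Type) [AddCommGroup M] [Module A M] [Module.FinitePresentation A M]
    [Module O M] [Module (O ⧸ Ideal.span {π}) M]
    [IsScalarTower O (O ⧸ Ideal.span {π}) M]
    [IsScalarTower (O ⧸ Ideal.span {π}) A M] :
    ∃ (k : ℕ) (πs : Fin k → O) (I : Fin k → Type),
      (∀ i, πs i ∈ IsLocalRing.maximalIdeal O) ∧
      (∀ i, πs i ≠ 0) ∧
      (∀ i, Countable (I i)) ∧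
      Nonempty (M ≃ₗ[O] ((i : Fin k) → (I i →₀ O ⧸ Ideal.span {πs i}))) := by
  have harch : ∀ d ∈ IsLocalRing.maximalIdeal O, ∃ s : ℕ, π ∣ d ^ s :=
    fun d hd => TorsionStructure.exists_dvd_pow_of_rank_le_one hrank hπne hd
  let : Algebra O A :=
    ((algebraMap (O ⧸ Ideal.span {π}) A).comp (algebraMap O (O ⧸ Ideal.span {π}))).toAlgebra
  have : IsScalarTower O (O ⧸ Ideal.span {π}) A := IsScalarTower.of_algebraMap_eq fun _ => rfl
  have : Algebra.FinitePresentation O (O ⧸ Ideal.span {π}) :=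
    Algebra.FinitePresentation.quotient ⟨{π}, by simp⟩
  have : Algebra.FinitePresentation O A :=
    Algebra.FinitePresentation.trans O (O ⧸ Ideal.span {π}) A
  have : IsScalarTower O A M := IsScalarTower.of_algebraMap_smul fun c x => by
    rw [IsScalarTower.algebraMap_apply O (O ⧸ Ideal.span {π}) A, algebraMap_smul, algebraMap_smul]
  obtain ⟨n, f, hf, hker⟩ := Algebra.FinitePresentation.out (R := O) (A := A)
  let : Algebra (MvPolynomial (Fin n) O) A := f.toRingHom.toAlgebra
  let : Module (MvPolynomial (Fin n) O) M := Module.compHom M f.toRingHom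
  have : IsScalarTower (MvPolynomial (Fin n) O) A M :=
    IsScalarTower.of_algebraMap_smul fun _ _ => rfl
  have : IsScalarTower O (MvPolynomial (Fin n) O) M :=
    IsScalarTower.of_algebraMap_smul fun c x => by
      rw [← algebraMap_smul A, ← algebraMap_smul A c x]
      exact congrArg (· • x) (f.commutes c)
  have : Module.FinitePresentation (MvPolynomial (Fin n) O) A :=
    Module.finitePresentation_of_surjective (Algebra.linearMap (MvPolynomial (Fin n) O) A) hf hker
  have : Module.FinitePresentation (MvPolynomial (Fin n) O) M :=
    Module.FinitePresentation.trans (MvPolynomial (Fin n) O) M A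
  refine TorsionStructure.exists_cyclic_decomposition_of_finitePresentation (n := n) hπne harch M
    fun x => ?_
  rw [← algebraMap_smul (O ⧸ Ideal.span {π}), Ideal.Quotient.algebraMap_eq,
    Ideal.Quotient.eq_zero_iff_mem.2 (Ideal.mem_span_singleton_self π), zero_smul]
end

section
/- Let O be a valuation ring with maximal ideal m whose value group embeds into the real numbers (i.e., O has rank at most one), and let k = O/m be its residue field. Let π be a nonzero element of m, let A be a finitely presented algebra over O/(π), and let M be a finitely presented A-module. Then the kernel of the natural O-linear map m ⊗_O M → M induced by the inclusion m ⊆ O (this kernel computes Tor₁^O(O/m, M)) is isomorphic, as an O-module, to M ⊗_O (O/m). In particular both are k-vector spaces of the same dimension. -/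
open TensorProduct

universe u

/-- The snake lemma for a middle vertical map which is injective. -/
theorem LinearMap.nonempty_ker_equiv_ker_of_snake {R M₁ M₂ M₃ N₁ N₂ N₃ C₁ C₂ : Type*} [CommRing R]
    [AddCommGroup M₁] [Module R M₁] [AddCommGroup M₂] [Module R M₂] [AddCommGroup M₃] [Module R M₃]
    [AddCommGroup N₁] [Module R N₁] [AddCommGroup N₂] [Module R N₂] [AddCommGroup N₃] [Module R N₃]
    [AddCommGroup C₁] [Module R C₁] [AddCommGroup C₂] [Module R C₂]
    (i₁ : M₁ →ₗ[R] N₁) (i₂ : M₂ →ₗ[R] N₂) (i₃ : M₃ →ₗ[R] N₃)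
    (f₁ : M₁ →ₗ[R] M₂) (f₂ : M₂ →ₗ[R] M₃) (hf : Function.Exact f₁ f₂)
    (g₁ : N₁ →ₗ[R] N₂) (g₂ : N₂ →ₗ[R] N₃) (hg : Function.Exact g₁ g₂)
    (h₁ : g₁ ∘ₗ i₁ = i₂ ∘ₗ f₁) (h₂ : g₂ ∘ₗ i₂ = i₃ ∘ₗ f₂)
    (π₁ : N₁ →ₗ[R] C₁) (hπ₁ : Function.Exact i₁ π₁)
    (π₂ : N₂ →ₗ[R] C₂) (hπ₂ : Function.Exact i₂ π₂)
    (hf₂ : Function.Surjective f₂) (hg₁ : Function.Injective g₁) (hi₂ : Function.Injective i₂)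
    (hπ₁' : Function.Surjective π₁) (G : C₁ →ₗ[R] C₂) (hG : G ∘ₗ π₁ = π₂ ∘ₗ g₁) :
    Nonempty (ker i₃ ≃ₗ[R] ker G) := by
  let δ := SnakeLemma.δ' i₁ i₂ i₃ f₁ f₂ hf g₁ g₂ hg h₁ h₂ (ker i₃).subtype
    (exact_subtype_ker_map i₃) π₁ hπ₁ hf₂ hg₁
  have hinj : Function.Injective δ :=
    (exact_zero_iff_injective PUnit.{1} _).mp
      (SnakeLemma.exact_δ'_right i₁ i₂ i₃ f₁ f₂ hf g₁ g₂ hg h₁ h₂ (0 : PUnit.{1} →ₗ[R] M₂)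
        ((exact_zero_iff_injective _ _).mpr hi₂) (ker i₃).subtype (exact_subtype_ker_map i₃)
        π₁ hπ₁ hf₂ hg₁ 0 (by simp) (ker i₃).subtype_injective)
  have hex : Function.Exact δ G :=
    SnakeLemma.exact_δ'_left i₁ i₂ i₃ f₁ f₂ hf g₁ g₂ hg h₁ h₂ (ker i₃).subtype
      (exact_subtype_ker_map i₃) π₁ hπ₁ π₂ hπ₂ hf₂ hg₁ G hG hπ₁'
  exact ⟨(LinearEquiv.ofInjective δ hinj).trans
    (LinearEquiv.ofEq _ _ hex.linearMap_ker_eq.symm)⟩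

/-- The kernel of the multiplication map `I ⊗ M → M`, i.e. `Tor₁(R ⧸ I, M)`. -/
abbrev Ideal.torKer {R : Type*} [CommRing R] (I : Ideal R) (M : Type*) [AddCommGroup M]
    [Module R M] : Submodule R (I ⊗[R] M) :=
  LinearMap.ker (TensorProduct.lift ((LinearMap.lsmul R M).comp I.subtype))

theorem Ideal.range_lift_lsmul_comp_subtype {R : Type*} [CommRing R] (I : Ideal R) (M : Type*)
    [AddCommGroup M] [Module R M] :
    LinearMap.range (TensorProduct.lift ((LinearMap.lsmul R M).comp I.subtype)) =
      I • (⊤ : Submodule R M) := by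
  apply le_antisymm
  · rintro _ ⟨z, rfl⟩
    induction z with
    | zero => simp
    | tmul a x => exact Submodule.smul_mem_smul a.2 trivial
    | add a b ha hb => rw [map_add]; exact add_mem ha hb
  · rw [Submodule.smul_le]
    exact fun a ha x _ ↦ ⟨⟨a, ha⟩ ⊗ₜ x, by simp⟩

theorem Ideal.exact_lift_lsmul_mk {R : Type*} [CommRing R] (I : Ideal R) (M : Type*)
    [AddCommGroup M] [Module R M] :
    Function.Exact (TensorProduct.lift ((LinearMap.lsmul R M).comp I.subtype))
      (TensorProduct.mk R (R ⧸ I) M 1) := by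
  rw [LinearMap.exact_iff, I.range_lift_lsmul_comp_subtype,
    ← TensorProduct.quotTensorEquivQuotSMul_symm_comp_mkQ, LinearEquiv.ker_comp,
    Submodule.ker_mkQ]

/-- For a presentation `0 → N → F → M → 0` with `F` flat, `Tor₁(R ⧸ I, M)` is the kernel of
`(R ⧸ I) ⊗ N → (R ⧸ I) ⊗ F`. -/
theorem Ideal.nonempty_torKer_equiv_ker_lTensor {R N F M : Type*} [CommRing R] (I : Ideal R)
    [AddCommGroup N] [Module R N] [AddCommGroup F] [Module R F] [AddCommGroup M] [Module R M]
    [Module.Flat R F] (f : N →ₗ[R] F) (g : F →ₗ[R] M) (hf : Function.Injective f)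
    (hg : Function.Surjective g) (hfg : Function.Exact f g) :
    Nonempty (I.torKer M ≃ₗ[R] LinearMap.ker (f.lTensor (R ⧸ I))) := by
  let actN : I ⊗[R] N →ₗ[R] N := TensorProduct.lift ((LinearMap.lsmul R N).comp I.subtype)
  let actF : I ⊗[R] F →ₗ[R] F := TensorProduct.lift ((LinearMap.lsmul R F).comp I.subtype)
  let actM : I ⊗[R] M →ₗ[R] M := TensorProduct.lift ((LinearMap.lsmul R M).comp I.subtype)
  have hactF : Function.Injective actF := by
    have := Module.Flat.rTensor_preserves_injective_linearMap (M := F) I.subtype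
      I.subtype_injective
    have h : actF = TensorProduct.lid R F ∘ₗ I.subtype.rTensor F := by ext; simp [actF]
    rw [h]
    exact (TensorProduct.lid R F).injective.comp this
  let π : N →ₗ[R] (R ⧸ I) ⊗[R] N := TensorProduct.mk R (R ⧸ I) N 1
  let ρ : F →ₗ[R] (R ⧸ I) ⊗[R] F := TensorProduct.mk R (R ⧸ I) F 1
  have hπ : Function.Surjective π := TensorProduct.mk_surjective _ _ _ Ideal.Quotient.mk_surjective
  have h₁ : f ∘ₗ actN = actF ∘ₗ f.lTensor I := by ext; simp [actN, actF]
  have h₂ : g ∘ₗ actF = actM ∘ₗ g.lTensor I := by ext; simp [actM, actF]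
  exact LinearMap.nonempty_ker_equiv_ker_of_snake actN actF actM (f.lTensor I) (g.lTensor I)
    (lTensor_exact I hfg hg) f g hfg h₁ h₂ π (I.exact_lift_lsmul_mk N) ρ (I.exact_lift_lsmul_mk F)
    (LinearMap.lTensor_surjective I hg)
    hf hactF hπ (f.lTensor (R ⧸ I)) (by ext; simp [π, ρ])

theorem LinearMap.nonempty_ker_equiv_of_finrank_eq {k A B C : Type*} [Field k]
    [AddCommGroup A] [Module k A] [AddCommGroup B] [Module k B] [AddCommGroup C] [Module k C]
    [Module.Finite k A] [Module.Finite k B] (h : Module.finrank k A = Module.finrank k B)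
    (φ : A →ₗ[k] B) (γ : B →ₗ[k] C) (hφγ : Function.Exact φ γ) (hγ : Function.Surjective γ) :
    Nonempty (LinearMap.ker φ ≃ₗ[k] C) := by
  have : Module.Finite k C := Module.Finite.of_surjective γ hγ
  have h1 := φ.finrank_range_add_finrank_ker
  have h2 := γ.finrank_range_add_finrank_ker
  rw [LinearMap.range_eq_top.mpr hγ, finrank_top, hφγ.linearMap_ker_eq] at h2
  exact ⟨LinearEquiv.ofFinrankEq _ _ (by omega)⟩

theorem ValuationRing.nonempty_torKer_equiv {V M : Type*} [CommRing V] [IsDomain V]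
    [ValuationRing V] [AddCommGroup M] [Module V M] [Module.FinitePresentation V M]
    (π : V) (hπ : π ≠ 0) (hM : ∀ x : M, π • x = 0) :
    Nonempty ((IsLocalRing.maximalIdeal V).torKer M ≃ₗ[V]
      M ⊗[V] (V ⧸ IsLocalRing.maximalIdeal V)) := by
  set m := IsLocalRing.maximalIdeal V
  let := Ideal.Quotient.field m
  obtain ⟨n, g, hg⟩ := Module.Finite.exists_fin' V M
  let N := LinearMap.ker g
  have hN : Module.Finite V N :=
    Module.Finite.of_fg (Module.FinitePresentation.fg_ker g hg)
  have : Module.Flat V N := Module.Flat.flat_iff_torsion_eq_bot_of_isBezout.mpr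
    ((Submodule.isTorsionFree_iff_torsion_eq_bot).mp inferInstance)
  have : Module.Free V N := Module.free_of_flat_of_isLocalRing
  have hrank : Module.finrank V N = Module.finrank V (Fin n → V) := by
    apply le_antisymm N.finrank_le
    let i : (Fin n → V) →ₗ[V] N := (LinearMap.lsmul V (Fin n → V) π).codRestrict N
      fun x ↦ by simp [N, hM]
    exact LinearMap.finrank_le_finrank_of_injective (f := i)
      (LinearMap.injective_codRestrict_iff _ |>.mpr (LinearMap.lsmul_injective hπ))
  have hex : Function.Exact N.subtype g := LinearMap.exact_subtype_ker_map g
  obtain ⟨e⟩ := m.nonempty_torKer_equiv_ker_lTensor N.subtype g N.subtype_injective hg hex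
  obtain ⟨e₁⟩ := LinearMap.nonempty_ker_equiv_of_finrank_eq (k := V ⧸ m)
    (by rw [Module.finrank_baseChange, Module.finrank_baseChange, hrank])
    (N.subtype.baseChange (V ⧸ m)) (g.baseChange (V ⧸ m)) (lTensor_exact (V ⧸ m) hex hg)
    (LinearMap.lTensor_surjective (V ⧸ m) hg)
  exact ⟨e.trans ((e₁.restrictScalars V).trans (TensorProduct.comm V _ _))⟩

theorem ValuationRing.exists_eq_tmul {V M : Type*} [CommRing V] [IsDomain V] [ValuationRing V]
    [AddCommGroup M] [Module V M] (I : Ideal V) (z : I ⊗[V] M) :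
    ∃ (b : I) (x : M), z = b ⊗ₜ x := by
  induction z with
  | zero => exact ⟨0, 0, by simp⟩
  | tmul b x => exact ⟨b, x, rfl⟩
  | add z w hz hw =>
    obtain ⟨a, x, rfl⟩ := hz
    obtain ⟨b, y, rfl⟩ := hw
    obtain ⟨c, hc⟩ | ⟨c, hc⟩ := ValuationRing.dvd_total (a : V) b
    · have : b = c • a := Subtype.ext (by simp [hc, mul_comm])
      exact ⟨a, x + c • y, by rw [this, tmul_add, smul_tmul]⟩
    · have : a = c • b := Subtype.ext (by simp [hc, mul_comm])
      exact ⟨b, c • x + y, by rw [this, tmul_add, smul_tmul]⟩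

theorem ValuationRing.exists_mem_forall_dvd {V ι : Type*} [CommRing V] [IsDomain V]
    [ValuationRing V] (f : ι → V) (s : Finset ι) (hs : s.Nonempty) :
    ∃ i ∈ s, ∀ j ∈ s, f i ∣ f j := by
  induction hs using Finset.Nonempty.cons_induction with
  | singleton a => exact ⟨a, by simp⟩
  | cons a s ha hs ih =>
    obtain ⟨i, hi, h⟩ := ih
    obtain h' | h' := ValuationRing.dvd_total (f a) (f i)
    · exact ⟨a, by simp, by simpa using fun j hj ↦ h'.trans (h j hj)⟩
    · exact ⟨i, by simp [hi], by simpa using ⟨h', h⟩⟩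

namespace MvPolynomial

/-- The ideal of the polynomials over a local ring all of whose coefficients are non-units. -/
noncomputable abbrev gaussIdeal (σ O : Type*) [CommRing O] [IsLocalRing O] :
    Ideal (MvPolynomial σ O) :=
  RingHom.ker (map (σ := σ) (IsLocalRing.residue O))

instance (σ O : Type*) [CommRing O] [IsLocalRing O] : (gaussIdeal σ O).IsPrime :=
  RingHom.ker_isPrime _

theorem exists_eq_C_mul {σ O : Type*} [CommRing O] [IsDomain O] [ValuationRing O]
    (f : MvPolynomial σ O) : ∃ (c : O) (u : MvPolynomial σ O), u ∉ gaussIdeal σ O ∧ f = C c * u := by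
  by_cases hf : f = 0
  · exact ⟨0, 1, by simp [RingHom.mem_ker], by simp [hf]⟩
  obtain ⟨i, hi, h⟩ := ValuationRing.exists_mem_forall_dvd (fun i ↦ coeff i f) f.support
    (support_nonempty.mpr hf)
  obtain ⟨u, hu⟩ : C (coeff i f) ∣ f := by
    rw [C_dvd_iff_dvd_coeff]
    intro j
    by_cases hj : j ∈ f.support
    · exact h j hj
    · simp [notMem_support_iff.mp hj]
  refine ⟨coeff i f, u, fun hu' ↦ ?_, hu⟩
  have h1 : coeff i u = 1 := by
    have := congrArg (coeff i) hu
    rw [coeff_C_mul] at this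
    exact (mul_left_cancel₀ (mem_support_iff.mp hi) (by rw [mul_one]; exact this)).symm
  have h2 := congrArg (coeff i) ((RingHom.mem_ker).mp hu')
  rw [coeff_map, h1] at h2
  simp at h2

variable {σ O : Type*} [CommRing O] [IsDomain O] [ValuationRing O]

theorem exists_eq_mul_algebraMap (a : Localization.AtPrime (gaussIdeal σ O)) :
    ∃ (c : O) (u : Localization.AtPrime (gaussIdeal σ O)), IsUnit u ∧
      a = u * algebraMap (MvPolynomial σ O) _ (C c) := by
  obtain ⟨⟨f, s⟩, h⟩ := IsLocalization.surj (gaussIdeal σ O).primeCompl a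
  obtain ⟨c, u, hu, rfl⟩ := exists_eq_C_mul f
  have hs := IsLocalization.map_units (Localization.AtPrime (gaussIdeal σ O)) s
  have hu' := IsLocalization.map_units (Localization.AtPrime (gaussIdeal σ O))
    (⟨u, hu⟩ : (gaussIdeal σ O).primeCompl)
  refine ⟨c, hs.unit⁻¹ * algebraMap (MvPolynomial σ O) _ u, (Units.isUnit _).mul hu', ?_⟩
  apply hs.mul_right_cancel
  simp only at h
  rw [h, map_mul]
  linear_combination (-(algebraMap (MvPolynomial σ O) (Localization.AtPrime (gaussIdeal σ O)) u *
    algebraMap (MvPolynomial σ O) _ (C c))) * hs.val_inv_mul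

instance : IsDomain (Localization.AtPrime (gaussIdeal σ O)) :=
  IsLocalization.isDomain_localization (Ideal.primeCompl_le_nonZeroDivisors _)

instance : ValuationRing (Localization.AtPrime (gaussIdeal σ O)) := by
  rw [ValuationRing.iff_dvd_total]
  refine ⟨fun a b ↦ ?_⟩
  obtain ⟨c, u, hu, rfl⟩ := exists_eq_mul_algebraMap a
  obtain ⟨d, v, hv, rfl⟩ := exists_eq_mul_algebraMap b
  rw [hu.mul_left_dvd, hv.dvd_mul_left, hv.mul_left_dvd, hu.dvd_mul_left]
  exact (ValuationRing.dvd_total c d).imp (fun h ↦ map_dvd _ (map_dvd C h))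
    (fun h ↦ map_dvd _ (map_dvd C h))

theorem C_mem_gaussIdeal {σ O : Type*} [CommRing O] [IsLocalRing O] {c : O} :
    (C c : MvPolynomial σ O) ∈ gaussIdeal σ O ↔ c ∈ IsLocalRing.maximalIdeal O := by
  rw [RingHom.mem_ker, map_C, C_eq_zero, IsLocalRing.residue_eq_zero_iff]

/-- If no polynomial with a unit coefficient kills `M`, then none kills `Tor₁(k, M)`. -/
theorem exists_mem_torKer_lTensor_lsmul_ne_zero {M : Type*} [AddCommGroup M] [Module O M]
    [Module (MvPolynomial σ O) M] [IsScalarTower O (MvPolynomial σ O) M]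
    [Module.FinitePresentation (MvPolynomial σ O) M]
    (π : O) (hπ : π ≠ 0) (hM : ∀ x : M, π • x = 0)
    (hann : Module.annihilator (MvPolynomial σ O) M ≤ gaussIdeal σ O)
    (g : MvPolynomial σ O) (hg : g ∉ gaussIdeal σ O) :
    ∃ z ∈ (IsLocalRing.maximalIdeal O).torKer M,
      (Algebra.lsmul O O M g).lTensor (IsLocalRing.maximalIdeal O) z ≠ 0 := by
  let P := MvPolynomial σ O
  let S := (gaussIdeal σ O).primeCompl
  let O' := Localization.AtPrime (gaussIdeal σ O)
  let M' := LocalizedModule S M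
  let m' := IsLocalRing.maximalIdeal O'
  let f : M →ₗ[P] M' := LocalizedModule.mkLinearMap S M
  have : Nontrivial M' :=
    (Module.mem_support_iff_of_finite (p := ⟨gaussIdeal σ O, inferInstance⟩)).mpr hann
  have hMz (x : M) : (C π : P) • x = 0 := by
    rw [← hM x, ← IsScalarTower.algebraMap_smul P π x]; rfl
  have hM' (x : M') : algebraMap P O' (C π) • x = 0 := by
    obtain ⟨⟨y, s⟩, h⟩ := IsLocalizedModule.surj S f x
    have hs := IsLocalization.map_units O' s
    rw [← hs.smul_eq_zero, smul_comm, algebraMap_smul, algebraMap_smul]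
    change (C π : P) • s • x = 0
    rw [h]
    simp only
    rw [← map_smul, hMz, map_zero]
  have hπ' : algebraMap P O' (C π) ≠ 0 := by
    rw [Ne, IsLocalization.to_map_eq_zero_iff O'
      (Ideal.primeCompl_le_nonZeroDivisors (gaussIdeal σ O)), C_eq_zero]
    exact hπ
  obtain ⟨e⟩ := ValuationRing.nonempty_torKer_equiv (algebraMap P O' (C π)) hπ' hM'
  have : Nontrivial (M' ⊗[O'] (O' ⧸ m')) := by
    by_contra hcon
    rw [not_nontrivial_iff_subsingleton] at hcon
    have h1 := (TensorProduct.tensorQuotEquivQuotSMul M' m').symm.toEquiv.subsingleton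
    rw [Submodule.Quotient.subsingleton_iff] at h1
    exact top_ne_bot (Submodule.eq_bot_of_le_smul_of_le_jacobson_bot m' (⊤ : Submodule O' M')
      Module.Finite.fg_top h1.ge (IsLocalRing.maximalIdeal_le_jacobson _))
  have : Nontrivial (m'.torKer M') := e.toEquiv.nontrivial
  obtain ⟨⟨z, hz⟩, hz0⟩ := exists_ne (0 : m'.torKer M')
  obtain ⟨b', x', rfl⟩ := ValuationRing.exists_eq_tmul m' z
  obtain ⟨b, u, hu, hb'⟩ := exists_eq_mul_algebraMap (b' : O')
  have hβ (c : IsLocalRing.maximalIdeal O) : algebraMap P O' (C (c : O)) ∈ m' :=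
    (IsLocalization.AtPrime.to_map_mem_maximal_iff O' (gaussIdeal σ O) _).mpr
      (C_mem_gaussIdeal.mpr c.2)
  have hb : b ∈ IsLocalRing.maximalIdeal O := by
    rw [← C_mem_gaussIdeal (σ := σ),
      ← IsLocalization.AtPrime.to_map_mem_maximal_iff O' (gaussIdeal σ O)]
    have := b'.2
    rwa [hb', Ideal.unit_mul_mem_iff_mem _ hu] at this
  let β (c : IsLocalRing.maximalIdeal O) : m' := ⟨_, hβ c⟩
  obtain ⟨⟨x, s⟩, hx⟩ := IsLocalizedModule.surj S f (u • x')
  have hs := IsLocalization.map_units O' s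
  have hx' : f x = algebraMap P O' s • u • x' := by
    rw [← hx, algebraMap_smul]; rfl
  have hb'' : b' = u • β ⟨b, hb⟩ := Subtype.ext hb'
  have h0 : β ⟨b, hb⟩ ⊗ₜ[O'] f x ≠ 0 := by
    rw [hx', tmul_smul, ← smul_tmul, ← hb'', Ne, hs.smul_eq_zero]
    simpa using hz0
  have h1 : f ((C b : P) • x) = 0 := by
    have h2 : (b' : O') • x' = 0 := hz
    rw [map_smul, hx', ← algebraMap_smul O' (C b : P), smul_comm, smul_smul _ u, mul_comm, ← hb',
      h2, smul_zero]
  obtain ⟨s', hs'⟩ := (IsLocalizedModule.eq_zero_iff S f).mp h1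
  refine ⟨⟨b, hb⟩ ⊗ₜ ((s' : P) • x), ?_, fun h ↦ h0 ?_⟩
  · rw [LinearMap.mem_ker]
    simp only [lift.tmul, LinearMap.comp_apply, Submodule.subtype_apply, LinearMap.lsmul_apply]
    rw [← algebraMap_smul P b, smul_comm]
    exact hs'
  · let Φ : IsLocalRing.maximalIdeal O ⊗[O] M →+ m' ⊗[O'] M' :=
      TensorProduct.liftAddHom
        { toFun c := (TensorProduct.mk O' m' M' (β c)).toAddMonoidHom.comp f.toAddMonoidHom
          map_zero' := by
            have : β 0 = 0 := Subtype.ext (by simp [β])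
            ext y
            simp [this]
          map_add' c d := by
            have : β (c + d) = β c + β d := Subtype.ext (by simp [β])
            ext y
            simp [this] }
        fun r c y ↦ by
          have h2 : β (r • c) = algebraMap P O' (C r) • β c :=
            Subtype.ext (by simp only [β, Submodule.coe_smul, smul_eq_mul, map_mul])
          have h3 : f (r • y) = algebraMap P O' (C r) • f y := by
            rw [algebraMap_smul, ← map_smul, ← algebraMap_smul P r y]; rfl
          simp [h2, h3]
    have h2 := congrArg Φ h
    have h3 : Φ (⟨b, hb⟩ ⊗ₜ (g • (s' : P) • x)) = β ⟨b, hb⟩ ⊗ₜ f (g • (s' : P) • x) := rfl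
    have h4 := IsLocalization.map_units O' (⟨g, hg⟩ * s' : S)
    rw [map_zero] at h2
    rw [← h4.smul_eq_zero, ← tmul_smul, algebraMap_smul, ← map_smul]
    rw [Submonoid.coe_mul, ← smul_smul]
    exact h3.symm.trans h2

/-- A polynomial ring acting on a module stabilises no nonzero finite submodule, unless some
polynomial with a unit coefficient kills that submodule. -/
theorem exists_notMem_gaussIdeal_of_finite {σ O W : Type*} [CommRing O] [IsLocalRing O]
    [AddCommGroup W] [Module O W] (i : σ) (ρ : MvPolynomial σ O →ₐ[O] Module.End O W)
    (K : Submodule O W) [Module.Finite O K] (hK : ∀ p, ∀ x ∈ K, ρ p x ∈ K) :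
    ∃ g ∉ gaussIdeal σ O, ∀ x ∈ K, ρ g x = 0 := by
  let T : Module.End O K := (ρ (X i)).restrict (hK (X i))
  obtain ⟨p, hp, h⟩ := LinearMap.exists_monic_and_aeval_eq_zero O T
  refine ⟨Polynomial.aeval (X i) p, fun hmem ↦ ?_, fun x hx ↦ ?_⟩
  · rw [RingHom.mem_ker] at hmem
    have h1 : map (IsLocalRing.residue O) (Polynomial.aeval (X i : MvPolynomial σ O) p) =
        Polynomial.aeval (X i) (p.map (IsLocalRing.residue O)) := by
      simp only [Polynomial.aeval_def, Polynomial.eval₂_map, Polynomial.hom_eval₂, map_X]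
      congr 1
      ext; simp [algebraMap_eq]
    have h2 := congrArg (aeval (R := IsLocalRing.ResidueField O)
      (fun _ : σ ↦ (Polynomial.X : Polynomial (IsLocalRing.ResidueField O)))) (h1.symm.trans hmem)
    rw [map_zero, ← Polynomial.aeval_algHom_apply, aeval_X, Polynomial.aeval_X_left_apply] at h2
    exact (hp.map (IsLocalRing.residue O)).ne_zero h2
  · rw [← Polynomial.aeval_algHom_apply]
    have h3 (q : Polynomial O) (y : K) :
        ((Polynomial.aeval T q y : K) : W) = Polynomial.aeval (ρ (X i)) q y := by
      induction q using Polynomial.induction_on' with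
      | add q r hq hr => simp [hq, hr]
      | monomial n a =>
        have : (((T ^ n) y : K) : W) = ((ρ (X i)) ^ n) y := by
          rw [Module.End.pow_restrict]; rfl
        simp [Polynomial.aeval_monomial, this]
    have := h3 p ⟨x, hx⟩
    rw [h] at this
    exact this.symm

theorem rank_tensorProduct_le_aleph0 {σ : Type} {O k N : Type u} [CommRing O] [Nontrivial O]
    [Finite σ]
    [Field k] [Algebra O k] [AddCommGroup N] [Module O N] [Module (MvPolynomial σ O) N]
    [IsScalarTower O (MvPolynomial σ O) N] [Module.Finite (MvPolynomial σ O) N] :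
    Module.rank k (k ⊗[O] N) ≤ Cardinal.aleph0 := by
  obtain ⟨n, g, hg⟩ := Module.Finite.exists_fin' (MvPolynomial σ O) N
  let g' : (Fin n → MvPolynomial σ O) →ₗ[O] N := g.restrictScalars O
  have h1 := LinearMap.rank_le_of_surjective (g'.baseChange k) (LinearMap.lTensor_surjective k hg)
  refine h1.trans ?_
  rw [Module.rank_baseChange, rank_pi]
  have : Module.rank O (MvPolynomial σ O) ≤ Cardinal.aleph0 := by
    rw [rank_eq_lift, Cardinal.lift_le_aleph0]
    exact Cardinal.mk_le_aleph0
  simpa using (mul_le_mul' (Cardinal.natCast_le_aleph0 (n := n)) this).trans_eq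
    Cardinal.aleph0_mul_aleph0

theorem _root_.LinearMap.nonempty_ker_equiv_of_rank_le_aleph0 {k A C : Type u} {B : Type*}
    [Field k] [AddCommGroup A] [Module k A] [AddCommGroup B] [Module k B] [AddCommGroup C]
    [Module k C] (f : A →ₗ[k] B) (hA : Module.rank k A ≤ Cardinal.aleph0)
    (hC : Module.rank k C ≤ Cardinal.aleph0) (hf : ¬ Module.Finite k (LinearMap.ker f))
    (hC' : ¬ Module.Finite k C) : Nonempty (LinearMap.ker f ≃ₗ[k] C) := by
  rw [← Module.rank_lt_aleph0_iff, not_lt] at hf hC'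
  exact ⟨LinearEquiv.ofRankEq _ _ ((((Submodule.rank_le _).trans hA).antisymm hf).trans
    (hC.antisymm hC').symm)⟩

theorem nonempty_torKer_equiv {O M : Type u} {d : ℕ} [CommRing O] [IsDomain O] [ValuationRing O]
    [AddCommGroup M] [Module O M]
    [Module (MvPolynomial (Fin d) O) M] [IsScalarTower O (MvPolynomial (Fin d) O) M]
    [Module.FinitePresentation (MvPolynomial (Fin d) O) M]
    (π : O) (hπ : π ≠ 0) (hM : ∀ x : M, π • x = 0)
    (hk : ∀ g : MvPolynomial (Fin d) O,
      (Algebra.lsmul O O M g).lTensor (O ⧸ IsLocalRing.maximalIdeal O) = 0 → g ∈ gaussIdeal _ O) :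
    Nonempty ((IsLocalRing.maximalIdeal O).torKer M ≃ₗ[O]
      M ⊗[O] (O ⧸ IsLocalRing.maximalIdeal O)) := by
  obtain rfl | hd := Nat.eq_zero_or_pos d
  · have : Module.FinitePresentation O (MvPolynomial (Fin 0) O) :=
      Module.FinitePresentation.of_equiv (MvPolynomial.isEmptyAlgEquiv O (Fin 0)).symm.toLinearEquiv
    have : Module.FinitePresentation O M := .trans O M (MvPolynomial (Fin 0) O)
    exact ValuationRing.nonempty_torKer_equiv π hπ hM
  let P := MvPolynomial (Fin d) O
  let m := IsLocalRing.maximalIdeal O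
  let := Ideal.Quotient.field m
  let ρ (X : Type u) [AddCommGroup X] [Module O X] : P →ₐ[O] Module.End O (X ⊗[O] M) :=
    (Module.End.lTensorAlgHom O M X).comp (Algebra.lsmul O O M)
  have hann : Module.annihilator P M ≤ gaussIdeal (Fin d) O := by
    intro g hg
    apply hk
    have : Algebra.lsmul O O M g = 0 := by
      ext x
      exact Module.mem_annihilator.mp hg x
    rw [this, LinearMap.lTensor_zero]
  have hfin₁ : ¬ Module.Finite O ((O ⧸ m) ⊗[O] M) := by
    intro hfin
    obtain ⟨g, hg, h⟩ := exists_notMem_gaussIdeal_of_finite ⟨0, hd⟩ (ρ (O ⧸ m)) ⊤ (by simp)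
    exact hg (hk g (LinearMap.ext fun x ↦ h x trivial))
  have hfin₂ : ¬ Module.Finite O (m.torKer M) := by
    intro hfin
    obtain ⟨g, hg, h⟩ := exists_notMem_gaussIdeal_of_finite ⟨0, hd⟩ (ρ m) (m.torKer M) (by
      intro p x hx
      have h : (TensorProduct.lift ((LinearMap.lsmul O M).comp m.subtype)) ∘ₗ
          (Algebra.lsmul O O M p).lTensor m = Algebra.lsmul O O M p ∘ₗ
            TensorProduct.lift ((LinearMap.lsmul O M).comp m.subtype) := by
        ext a y
        exact smul_comm (a : O) p y
      rw [LinearMap.mem_ker] at hx ⊢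
      exact (LinearMap.congr_fun h x).trans (by simp [hx]))
    obtain ⟨z, hz, hz0⟩ := exists_mem_torKer_lTensor_lsmul_ne_zero π hπ hM hann g hg
    exact hz0 (h z hz)
  obtain ⟨n, g, hg⟩ := Module.Finite.exists_fin' P M
  let N := LinearMap.ker g
  have hN : Module.Finite P N := Module.Finite.of_fg (Module.FinitePresentation.fg_ker g hg)
  have hex : Function.Exact N.subtype g := LinearMap.exact_subtype_ker_map g
  obtain ⟨e⟩ := m.nonempty_torKer_equiv_ker_lTensor (N.subtype.restrictScalars O)
    (g.restrictScalars O) N.subtype_injective hg hex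
  let f := (N.subtype.restrictScalars O).baseChange (O ⧸ m)
  have h1 : Module.rank (O ⧸ m) ((O ⧸ m) ⊗[O] M) ≤ Cardinal.aleph0 :=
    rank_tensorProduct_le_aleph0 (σ := Fin d)
  have h2 : Module.rank (O ⧸ m) ((O ⧸ m) ⊗[O] N) ≤ Cardinal.aleph0 :=
    rank_tensorProduct_le_aleph0 (σ := Fin d)
  obtain ⟨e'⟩ := LinearMap.nonempty_ker_equiv_of_rank_le_aleph0 f h2 h1
    (fun h ↦ hfin₂ <| by
      have : Module.Finite O (LinearMap.ker f) := .trans (O ⧸ m) _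
      have : Module.Finite O
        (LinearMap.ker ((N.subtype.restrictScalars O).lTensor (O ⧸ m))) := this
      exact .equiv e.symm)
    (fun h ↦ hfin₁ (.trans (O ⧸ m) _))
  exact ⟨e.trans ((e'.restrictScalars O).trans (TensorProduct.comm O _ _))⟩

end MvPolynomial

/-- A finitely presented module which is also a module over a quotient ring is finitely presented
over that quotient. -/
theorem Module.FinitePresentation.of_surjective_algebraMap {A B M : Type*} [CommRing A]
    [CommRing B] [Algebra A B] [AddCommGroup M] [Module A M] [Module B M] [IsScalarTower A B M]
    [Module.FinitePresentation A M] (h : Function.Surjective (algebraMap A B)) :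
    Module.FinitePresentation B M := by
  obtain ⟨n, g, hg⟩ := Module.Finite.exists_fin' A M
  let g' : (Fin n → B) →ₗ[B] M := Fintype.linearCombination B (fun i ↦ g (Pi.single i 1))
  let c : (Fin n → A) →ₗ[A] (Fin n → B) := (Algebra.linearMap A B).compLeft (Fin n)
  have hc : Function.Surjective c := h.comp_left
  have hcg : (g'.restrictScalars A) ∘ₗ c = g := by
    ext i
    have : (fun j ↦ algebraMap A B ((Pi.single i 1 : Fin n → A) j)) = Pi.single i 1 := by
      ext j
      by_cases hj : j = i <;> simp [hj]
    simp [g', c, LinearMap.compLeft, Function.comp_def, this]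
  have hg' : Function.Surjective g' := fun x ↦ by
    obtain ⟨y, rfl⟩ := hg x
    exact ⟨c y, LinearMap.congr_fun hcg y⟩
  refine Module.finitePresentation_of_surjective g' hg' ?_
  have hker : (LinearMap.ker g').restrictScalars A = (LinearMap.ker g).map c := by
    rw [← hcg, LinearMap.ker_comp, Submodule.map_comap_eq_of_surjective hc]
    rfl
  have : ((LinearMap.ker g').restrictScalars A).FG := by
    rw [hker]
    exact (Module.FinitePresentation.fg_ker g hg).map c
  obtain ⟨s, hs⟩ := this
  refine ⟨s, le_antisymm (Submodule.span_le.mpr fun x hx ↦ ?_) fun x hx ↦ ?_⟩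
  · have : x ∈ (LinearMap.ker g').restrictScalars A := hs ▸ Submodule.subset_span hx
    exact this
  · have : x ∈ Submodule.span A (s : Set (Fin n → B)) := hs ▸ hx
    exact Submodule.span_le_restrictScalars A B _ this

/-- If every element of `A` is integral over `P` modulo the annihilator of a finitely presented
`A`-module `M`, then `M` is finitely presented over `P`. -/
theorem Module.FinitePresentation.of_forall_exists_monic {P A M : Type*} [CommRing P] [CommRing A]
    [Algebra P A] [Algebra.FinitePresentation P A] [AddCommGroup M] [Module A M] [Module P M]
    [IsScalarTower P A M] [Module.FinitePresentation A M]
    (h : ∀ x : A, ∃ q : Polynomial P, q.Monic ∧ Polynomial.aeval x q ∈ Module.annihilator A M) :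
    Module.FinitePresentation P M := by
  choose q hq hqM using h
  obtain ⟨s, hs⟩ := (inferInstance : Algebra.FiniteType P A).out
  let I : Ideal A := Ideal.span ((fun x ↦ Polynomial.aeval x (q x)) '' s)
  have hIM : I ≤ Module.annihilator A M := by
    rw [Ideal.span_le]
    rintro _ ⟨x, -, rfl⟩
    exact hqM x
  have hI : I.FG := Submodule.fg_span (s.finite_toSet.image _)
  have hfp : Algebra.FinitePresentation P (A ⧸ I) := .quotient hI
  have hint : Algebra.IsIntegral P (A ⧸ I) := by
    have hmap : (Algebra.adjoin P (s : Set A)).map (Ideal.Quotient.mkₐ P I) = ⊤ := by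
      rw [hs, Algebra.map_top, AlgHom.range_eq_top]
      exact Ideal.Quotient.mkₐ_surjective P I
    rw [AlgHom.map_adjoin] at hmap
    rw [← integralClosure_eq_top_iff, eq_top_iff, ← hmap]
    refine Algebra.adjoin_le ?_
    rintro _ ⟨x, hx, rfl⟩
    refine ⟨q x, hq x, ?_⟩
    rw [← Polynomial.aeval_def, Polynomial.aeval_algHom_apply]
    exact Ideal.Quotient.eq_zero_iff_mem.mpr (Ideal.subset_span ⟨x, hx, rfl⟩)
  have : Module.Finite P (A ⧸ I) := Algebra.IsIntegral.finite
  have : Module.FinitePresentation P (A ⧸ I) := .of_finite_of_finitePresentation P (A ⧸ I)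
  let : Module (A ⧸ I) M := Module.IsTorsionBySet.module (I := I)
    fun x a ↦ Module.mem_annihilator.mp (hIM a.2) x
  have : IsScalarTower A (A ⧸ I) M := Module.IsTorsionBySet.isScalarTower _
  have : IsScalarTower P (A ⧸ I) M := .of_algebraMap_smul fun p x ↦ by
    rw [IsScalarTower.algebraMap_apply P A (A ⧸ I), algebraMap_smul, algebraMap_smul]
  have : Module.FinitePresentation (A ⧸ I) M :=
    .of_surjective_algebraMap (A := A) Ideal.Quotient.mk_surjective
  exact .trans P M (A ⧸ I)

theorem ValuationRing.exists_dvd_pow {O : Type*} [CommRing O] [IsDomain O] [ValuationRing O]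
    (hrank : ∃ f : ValuationRing.ValueGroup O (FractionRing O) →*₀ NNReal, StrictMono f)
    {π t : O} (hπ : π ≠ 0) (ht : t ∈ IsLocalRing.maximalIdeal O) : ∃ n, π ∣ t ^ n := by
  obtain ⟨f, hf⟩ := hrank
  let v := ValuationRing.valuation O (FractionRing O)
  have hdvd (a b : O) (h : v (algebraMap O _ a) ≤ v (algebraMap O _ b)) : b ∣ a := by
    obtain ⟨c, hc⟩ := h
    refine ⟨c, IsFractionRing.injective O (FractionRing O) ?_⟩
    rw [mul_comm, map_mul, ← hc, Algebra.smul_def]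
  have h1 : f (v (algebraMap O _ t)) < 1 := by
    rw [← map_one f]
    refine hf (lt_of_not_ge fun h ↦ ?_)
    rw [← map_one v, ← map_one (algebraMap O (FractionRing O))] at h
    exact (IsLocalRing.mem_maximalIdeal t).mp ht (isUnit_of_dvd_one (hdvd 1 t h))
  have h0 : 0 < f (v (algebraMap O _ π)) := by
    rw [← map_zero f]
    refine hf (zero_lt_iff.mpr ?_)
    rw [Valuation.ne_zero_iff]
    simpa using hπ
  obtain ⟨n, hn⟩ := exists_pow_lt_of_lt_one h0 h1
  refine ⟨n, hdvd _ _ ?_⟩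
  rw [map_pow, map_pow, ← hf.le_iff_le, map_pow]
  exact hn.le

/-- If `a` acts as zero on `M ⊗ O/m`, for a finite module `M` over an `O`-algebra killed by some
nonzero `π`, then a power of `a` kills `M`. -/
theorem ValuationRing.exists_pow_mem_annihilator {O A M : Type*} [CommRing O] [IsDomain O]
    [ValuationRing O] [CommRing A] [Algebra O A] [AddCommGroup M] [Module O M] [Module A M]
    [IsScalarTower O A M] [Module.Finite A M] (π : O)
    (hπ : ∀ t ∈ IsLocalRing.maximalIdeal O, ∃ n, π ∣ t ^ n) (hM : ∀ x : M, π • x = 0) (a : A)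
    (ha : (Algebra.lsmul O O M a).lTensor (O ⧸ IsLocalRing.maximalIdeal O) = 0) :
    ∃ n, a ^ n ∈ Module.annihilator A M := by
  have h1 (x : M) : ∃ t ∈ IsLocalRing.maximalIdeal O, ∃ y, a • x = t • y := by
    have h := (IsLocalRing.maximalIdeal O).exact_lift_lsmul_mk M (a • x)
    obtain ⟨z, hz⟩ := h.mp (LinearMap.congr_fun ha (1 ⊗ₜ x))
    obtain ⟨t, y, rfl⟩ := ValuationRing.exists_eq_tmul _ z
    exact ⟨t, t.2, y, by simpa using hz.symm⟩
  obtain ⟨s, hs⟩ := (inferInstance : Module.Finite A M).fg_top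
  choose t ht y hy using h1
  obtain ⟨u, hu, hdvd⟩ : ∃ u ∈ IsLocalRing.maximalIdeal O, ∀ x ∈ s, u ∣ t x := by
    classical
    obtain ⟨i, -, hi⟩ := ValuationRing.exists_mem_forall_dvd t (insert 0 s) (by simp)
    exact ⟨t i, ht i, fun x hx ↦ hi x (by simp [hx])⟩
  have h2 (x : M) : ∃ y, a • x = u • y := by
    have hx : x ∈ Submodule.span A (s : Set M) := hs ▸ trivial
    induction hx using Submodule.span_induction with
    | mem x hx =>
      obtain ⟨c, hc⟩ := hdvd x hx
      exact ⟨c • y x, by rw [hy, hc, mul_smul]⟩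
    | zero => exact ⟨0, by simp⟩
    | add x y _ _ hx hy =>
      obtain ⟨x', hx'⟩ := hx
      obtain ⟨y', hy'⟩ := hy
      exact ⟨x' + y', by rw [smul_add, smul_add, hx', hy']⟩
    | smul b x _ hx =>
      obtain ⟨x', hx'⟩ := hx
      exact ⟨b • x', by rw [smul_comm, hx', smul_comm]⟩
  have h3 (n : ℕ) (x : M) : ∃ y, a ^ n • x = u ^ n • y := by
    induction n with
    | zero => exact ⟨x, by simp⟩
    | succ n ih =>
      obtain ⟨y, hy⟩ := ih
      obtain ⟨z, hz⟩ := h2 y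
      exact ⟨z, by rw [pow_succ', mul_smul, hy, smul_comm, hz, pow_succ, mul_smul]⟩
  obtain ⟨n, c, hc⟩ := hπ u hu
  refine ⟨n, Module.mem_annihilator.mpr fun x ↦ ?_⟩
  obtain ⟨y, hy⟩ := h3 n x
  rw [hy, hc, mul_smul, hM]

/-- Noether normalization of the special fibre, lifted to a local base ring. -/
theorem MvPolynomial.exists_algHom_of_le {O A : Type*} [CommRing O] [IsLocalRing O] [CommRing A]
    [Algebra O A] [Algebra.FiniteType O A] (J : Ideal A) (hJ : J ≠ ⊤)
    (hm : ∀ t ∈ IsLocalRing.maximalIdeal O, algebraMap O A t ∈ J) :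
    ∃ (d : ℕ) (φ : MvPolynomial (Fin d) O →ₐ[O] A),
      (∀ p, φ p ∈ J → p ∈ gaussIdeal (Fin d) O) ∧
      ∀ x, ∃ q : Polynomial (MvPolynomial (Fin d) O), q.Monic ∧
        q.eval₂ (φ : MvPolynomial (Fin d) O →+* A) x ∈ J := by
  let k := IsLocalRing.ResidueField O
  have : Nontrivial (A ⧸ J) := Ideal.Quotient.nontrivial_iff.mpr hJ
  let : Algebra k (A ⧸ J) := (Ideal.Quotient.lift (IsLocalRing.maximalIdeal O)
    (algebraMap O (A ⧸ J)) fun t ht ↦ Ideal.Quotient.eq_zero_iff_mem.mpr (hm t ht)).toAlgebra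
  have : IsScalarTower O k (A ⧸ J) := .of_algebraMap_eq fun _ ↦ rfl
  have : Algebra.FiniteType k (A ⧸ J) := .of_restrictScalars_finiteType O k (A ⧸ J)
  obtain ⟨d, g, hg, hint⟩ := exists_integral_inj_algHom_of_fg k (A ⧸ J)
  choose Y hY using fun i ↦ Ideal.Quotient.mk_surjective (g (X i))
  let φ : MvPolynomial (Fin d) O →ₐ[O] A := aeval Y
  have hφ (p) : Ideal.Quotient.mk J (φ p) = g (map (IsLocalRing.residue O) p) := by
    have : (Ideal.Quotient.mk J).comp (φ : MvPolynomial (Fin d) O →+* A) =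
        (g : MvPolynomial (Fin d) k →+* A ⧸ J).comp (map (IsLocalRing.residue O)) := by
      ext i
      · simp only [RingHom.comp_apply, RingHom.coe_coe, map_C, φ]
        rw [← algebraMap_eq, ← algebraMap_eq, AlgHom.commutes, AlgHom.commutes]
        rfl
      · simp [φ, hY]
    exact congrArg (· p) (congrArg DFunLike.coe this)
  refine ⟨d, φ, fun p hp ↦ ?_, fun x ↦ ?_⟩
  · rw [← Ideal.Quotient.eq_zero_iff_mem, hφ] at hp
    exact hg (hp.trans (map_zero g).symm)
  · obtain ⟨q, hq, hqx⟩ := hint (Ideal.Quotient.mk J x)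
    obtain ⟨r, hr, -, hrm⟩ := Polynomial.lifts_and_degree_eq_and_monic
      (f := map (σ := Fin d) (IsLocalRing.residue O)) (p := q)
      ((Polynomial.lifts_iff_coeff_lifts _).mpr fun n ↦
        map_surjective _ IsLocalRing.residue_surjective _) hq
    refine ⟨r, hrm, ?_⟩
    rw [← Ideal.Quotient.eq_zero_iff_mem, Polynomial.hom_eval₂, ← hqx, ← hr,
      Polynomial.eval₂_map]
    congr 1
    exact RingHom.ext hφ

/-- Let `O` be a valuation ring of rank at most one (its value group
embeds into the reals, stated multiplicatively: it embeds into `ℝ≥0` by a strictly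
monotone homomorphism of monoids with zero), with maximal ideal `m`.  Let `π` be a
nonzero element of `m`, `A` a finitely presented algebra over `O/(π)` and `M` a finitely
presented `A`-module.  Then the kernel of the natural `O`-linear map `m ⊗[O] M → M`
(which computes `Tor₁^O(O/m, M)`) is isomorphic as an `O`-module to `M ⊗[O] (O/m)`. -/
theorem ker_tensor_action_iso_tensor_residue
    (O : Type) [CommRing O] [IsDomain O] [ValuationRing O]
    (hrank : ∃ f : ValuationRing.ValueGroup O (FractionRing O) →*₀ NNReal, StrictMono f)
    (π : O) (hπmem : π ∈ IsLocalRing.maximalIdeal O) (hπne : π ≠ 0)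
    (A : Type) [CommRing A] [Algebra (O ⧸ Ideal.span {π}) A]
    [Algebra.FinitePresentation (O ⧸ Ideal.span {π}) A]
    (M : Type) [AddCommGroup M] [Module A M] [Module.FinitePresentation A M]
    [Module O M] [Module (O ⧸ Ideal.span {π}) M]
    [IsScalarTower O (O ⧸ Ideal.span {π}) M]
    [IsScalarTower (O ⧸ Ideal.span {π}) A M] :
    Nonempty
      ((LinearMap.ker (TensorProduct.lift
          ((LinearMap.lsmul O M).comp (IsLocalRing.maximalIdeal O).subtype)))
        ≃ₗ[O] TensorProduct O M (O ⧸ IsLocalRing.maximalIdeal O)) := by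
  let : Algebra O A :=
    ((algebraMap (O ⧸ Ideal.span {π}) A).comp (Ideal.Quotient.mk (Ideal.span {π}))).toAlgebra
  have : IsScalarTower O (O ⧸ Ideal.span {π}) A := .of_algebraMap_eq fun _ ↦ rfl
  have : IsScalarTower O A M := .of_algebraMap_smul fun a x ↦ by
    rw [IsScalarTower.algebraMap_apply O (O ⧸ Ideal.span {π}) A, algebraMap_smul, algebraMap_smul]
  have : Algebra.FinitePresentation O (O ⧸ Ideal.span {π}) :=
    .quotient (Submodule.fg_span (Set.finite_singleton π))
  have : Algebra.FinitePresentation O A := .trans O (O ⧸ Ideal.span {π}) A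
  have hM (x : M) : π • x = 0 := by
    have h : Ideal.Quotient.mk (Ideal.span {π}) π = 0 :=
      Ideal.Quotient.eq_zero_iff_mem.mpr (Ideal.mem_span_singleton_self π)
    rw [← algebraMap_smul (O ⧸ Ideal.span {π}), Ideal.Quotient.algebraMap_eq, h, zero_smul]
  let m := IsLocalRing.maximalIdeal O
  let J : Ideal A :=
    RingHom.ker ((Module.End.lTensorAlgHom O M (O ⧸ m)).comp (Algebra.lsmul O O M))
  have hJ (a : A) (ha : a ∈ J) : ∃ n, a ^ n ∈ Module.annihilator A M :=
    ValuationRing.exists_pow_mem_annihilator π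
      (fun _ ↦ ValuationRing.exists_dvd_pow hrank hπne) hM a ha
  by_cases hJ_top : J = ⊤
  · obtain ⟨n, hn⟩ := hJ 1 (hJ_top ▸ trivial)
    have : Subsingleton M := by
      rw [← Module.annihilator_eq_top_iff (R := A), Ideal.eq_top_iff_one]
      simpa using hn
    exact ⟨LinearEquiv.ofSubsingleton _ _⟩
  have hmJ (t : O) (ht : t ∈ m) : algebraMap O A t ∈ J := by
    change ((Algebra.lsmul O O M) (algebraMap O A t)).lTensor (O ⧸ m) = 0
    refine TensorProduct.ext' fun c x ↦ ?_
    have hc : t • c = 0 := by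
      rw [Algebra.smul_def, Ideal.Quotient.algebraMap_eq, Ideal.Quotient.eq_zero_iff_mem.mpr ht,
        zero_mul]
    simp only [LinearMap.lTensor_tmul, Algebra.lsmul_coe, algebraMap_smul, LinearMap.zero_apply]
    rw [← smul_tmul, hc, zero_tmul]
  obtain ⟨d, φ, hφ, hint⟩ := MvPolynomial.exists_algHom_of_le J hJ_top hmJ
  let P := MvPolynomial (Fin d) O
  let : Algebra P A := φ.toRingHom.toAlgebra
  have : IsScalarTower O P A := .of_algebraMap_eq fun x ↦ (φ.commutes x).symm
  let : Module P M := Module.compHom M φ.toRingHom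
  have : IsScalarTower P A M := .of_algebraMap_smul fun _ _ ↦ rfl
  have : IsScalarTower O P M := .of_algebraMap_smul fun a x ↦ by
    rw [← algebraMap_smul A (algebraMap O P a) x, ← IsScalarTower.algebraMap_apply,
      algebraMap_smul]
  have : Algebra.FinitePresentation P A := .of_restrict_scalars_finitePresentation O P A
  have : Module.FinitePresentation P M := by
    refine .of_forall_exists_monic (A := A) fun x ↦ ?_
    obtain ⟨q, hq, hqJ⟩ := hint x
    obtain ⟨n, hn⟩ := hJ _ hqJ
    exact ⟨q ^ n, hq.pow n, by rwa [map_pow]⟩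
  exact MvPolynomial.nonempty_torKer_equiv (d := d) π hπne hM fun g hg ↦ hφ g hg
end

section
/- Let O be a valuation ring with maximal ideal m and residue field k = O/m. Let B = O[X₁,…,X_d] be the polynomial ring over O, let p ⊆ B be the prime ideal of polynomials all of whose coefficients lie in m, and let B_p be the localization of B at p. Then the localization map B → B_p is universally injective as a map of O-modules: for every O-module N, the induced map N ⊗_O B → N ⊗_O B_p is injective. -/
open TensorProduct

theorem TensorProduct.rTensor_equivFinsuppOfBasisRight_symm
    {R ι F M N : Type*} [CommRing R] [DecidableEq ι] [AddCommGroup F] [Module R F]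
    [AddCommGroup M] [Module R M] [AddCommGroup N] [Module R N]
    (b : Module.Basis ι R F) (g : M →ₗ[R] N) (n : ι →₀ M) :
    g.rTensor F ((equivFinsuppOfBasisRight b).symm n) =
      (equivFinsuppOfBasisRight b).symm (n.mapRange g (map_zero g)) := by
  rw [equivFinsuppOfBasisRight_symm_apply, equivFinsuppOfBasisRight_symm_apply,
    Finsupp.sum_mapRange_index (by simp), Finsupp.sum, Finsupp.sum, map_sum]
  simp

/-- Over a local ring, a linear map between flat modules whose source is free is universally
injective as soon as it is injective modulo the maximal ideal. -/
theorem IsLocalRing.lTensor_injective_of_lTensor_residueField_injective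
    {R F G : Type*} [CommRing R] [IsLocalRing R] [AddCommGroup F] [Module R F] [Module.Free R F]
    [AddCommGroup G] [Module R G] [Module.Flat R G] (φ : F →ₗ[R] G)
    (hφ : Function.Injective (φ.lTensor (ResidueField R)))
    (N : Type*) [AddCommGroup N] [Module R N] :
    Function.Injective (φ.lTensor N) := by
  classical
  rw [injective_iff_map_eq_zero]
  intro x hx
  let b := Module.Free.chooseBasis R F
  obtain ⟨n, rfl⟩ := (equivFinsuppOfBasisRight b).symm.surjective x
  suffices h : n = 0 by simp [h]
  let M : Submodule R N := Submodule.span R (n '' n.support)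
  have : Module.Finite R M :=
    Module.Finite.iff_fg.mpr (Submodule.fg_span (n.support.finite_toSet.image _))
  have hnM (i) : n i ∈ M := by
    by_cases hi : i ∈ n.support
    · exact Submodule.subset_span ⟨i, hi, rfl⟩
    · rw [Finsupp.notMem_support_iff.mp hi]; exact M.zero_mem
  let n' : Module.Free.ChooseBasisIndex R F →₀ M :=
    Finsupp.onFinset n.support (fun i ↦ ⟨n i, hnM i⟩) (by simp)
  have hn' : n = n'.mapRange M.subtype rfl := by ext; simp [n']
  let y : M ⊗[R] F := (equivFinsuppOfBasisRight b).symm n'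
  have hy : φ.lTensor M y = 0 := by
    apply Module.Flat.rTensor_preserves_injective_linearMap (M := G) M.subtype
      M.injective_subtype
    rw [map_zero, ← hx, ← LinearMap.comp_apply, LinearMap.rTensor_comp_lTensor,
      ← LinearMap.lTensor_comp_rTensor, LinearMap.comp_apply]
    rw [rTensor_equivFinsuppOfBasisRight_symm, hn']
  have hg (g : M →ₗ[R] ResidueField R) (i) : g (n' i) = 0 := by
    have hgy : g.rTensor F y = 0 := by
      apply hφ
      rw [map_zero, ← LinearMap.comp_apply, LinearMap.lTensor_comp_rTensor,
        ← LinearMap.rTensor_comp_lTensor, LinearMap.comp_apply, hy, map_zero]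
    rw [rTensor_equivFinsuppOfBasisRight_symm, LinearEquiv.map_eq_zero_iff] at hgy
    simpa using DFunLike.congr_fun hgy i
  have hg' (g : M →ₗ[R] ResidueField R) : g = 0 := by
    refine LinearMap.ext fun ⟨m, hm⟩ ↦ ?_
    induction hm using Submodule.span_induction with
    | mem m hm =>
      obtain ⟨i, -, rfl⟩ := hm
      exact hg g i
    | zero => exact map_zero g
    | add u v hu hv h₁ h₂ =>
      simpa [h₁, h₂] using map_add g ⟨u, hu⟩ ⟨v, hv⟩
    | smul r u hu h =>
      simpa [h] using map_smul g r ⟨u, hu⟩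
  have : Subsingleton (ResidueField R ⊗[R] M) := by
    refine subsingleton_of_forall_eq 0 fun z ↦ ?_
    rw [← Module.forall_dual_apply_eq_zero_iff (ResidueField R)]
    intro f
    have hf : f = 0 := by
      apply TensorProduct.AlgebraTensorModule.curry_injective
      ext m
      exact LinearMap.congr_fun
        (hg' (f.restrictScalars R ∘ₗ TensorProduct.mk R (ResidueField R) M 1)) m
    simp [hf]
  rw [IsLocalRing.subsingleton_tensorProduct] at this
  ext i
  exact congrArg Subtype.val (Subsingleton.elim (n' i) 0)

/-- Multiplication by a polynomial over a local ring with some unit coefficient is universally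
injective. -/
theorem MvPolynomial.lTensor_mulLeft_injective_of_coeff_notMem_maximalIdeal
    {R σ : Type*} [CommRing R] [IsLocalRing R] {s : MvPolynomial σ R} {m : σ →₀ ℕ}
    (hs : coeff m s ∉ IsLocalRing.maximalIdeal R) (N : Type*) [AddCommGroup N] [Module R N] :
    Function.Injective ((LinearMap.mulLeft R s).lTensor N) := by
  apply IsLocalRing.lTensor_injective_of_lTensor_residueField_injective
  let k := IsLocalRing.ResidueField R
  let e := algebraTensorAlgEquiv (σ := σ) R k
  have map_ne : map (algebraMap R k) s ≠ 0 := by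
    intro h
    apply hs
    rw [← IsLocalRing.residue_eq_zero_iff]
    exact (coeff_map _ _ _).symm.trans (congrArg (coeff m) h)
  have key (z) : e ((LinearMap.mulLeft R s).lTensor k z) = map (algebraMap R k) s * e z := by
    induction z with
    | zero => simp
    | add u v hu hv => simp only [map_add, hu, hv, mul_add]
    | tmul a p => simp [e]
  rw [injective_iff_map_eq_zero]
  intro z hz
  have := key z
  rw [hz, map_zero, eq_comm, mul_eq_zero] at this
  exact (map_eq_zero_iff e e.injective).mp (this.resolve_left map_ne)

/-- Let `O` be a valuation ring with maximal ideal `m`, let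
`B = O[X₁,…,X_d]`, let `p ⊆ B` be the prime ideal of polynomials all of whose
coefficients lie in `m`, and let `B_p` be the localization of `B` at `p`.  Then the
localization map `B → B_p` is universally injective as a map of `O`-modules: for every
`O`-module `N`, the induced map `N ⊗[O] B → N ⊗[O] B_p` is injective. -/
theorem localization_map_universally_injective
    (O : Type) [CommRing O] [IsDomain O] [ValuationRing O]
    (d : ℕ) (p : Ideal (MvPolynomial (Fin d) O))
    (hpdef : ∀ f : MvPolynomial (Fin d) O,
      f ∈ p ↔ ∀ m : Fin d →₀ ℕ, MvPolynomial.coeff m f ∈ IsLocalRing.maximalIdeal O)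
    (hp : p.IsPrime) :
    ∀ (N : Type) [AddCommGroup N] [Module O N],
      Function.Injective
        (LinearMap.lTensor N
          (IsScalarTower.toAlgHom O (MvPolynomial (Fin d) O)
            (Localization.AtPrime p)).toLinearMap) := by
  intro N _ _
  let g := Algebra.linearMap (MvPolynomial (Fin d) O) (Localization.AtPrime p)
  have : IsLocalizedModule p.primeCompl
      (AlgebraTensorModule.rTensor O N g) := inferInstance
  have h : Function.Injective (AlgebraTensorModule.rTensor O N g) := by
    rw [injective_iff_map_eq_zero]
    intro x hx
    obtain ⟨⟨s, hs⟩, hsx⟩ := (IsLocalizedModule.eq_zero_iff p.primeCompl _).mp hx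
    obtain ⟨m, hm⟩ := not_forall.mp (mt (hpdef s).mpr hs)
    have hinj := MvPolynomial.lTensor_mulLeft_injective_of_coeff_notMem_maximalIdeal hm N
    rw [LinearMap.lTensor_inj_iff_rTensor_inj, injective_iff_map_eq_zero] at hinj
    refine hinj x (.trans ?_ hsx)
    clear hsx hx
    induction x with
    | zero => simp
    | add u v hu hv => simp only [map_add, hu, hv, smul_add]
    | tmul a n => simp [Submonoid.smul_def, smul_tmul']
  rw [LinearMap.lTensor_inj_iff_rTensor_inj]
  exact h
end
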